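/- (Cordero-Erausquin–Ledoux) There is an absolute constant C > 0 such that for every n ≥ 1 and every smooth (C¹, with gradient in L¹(γ_n)) function f : ℝⁿ → ℝ with |f(x)| ≤ 1 for all x: Var_{γ_n}(f) ≤ C · Σ_{i=1}^n ‖∂_i f‖₁ (1 + ‖∂_i f‖₁) / [1 + log⁺(1/‖∂_i f‖₁)]^{1/2}, where log⁺(u) = max(log u, 0), with the convention that a summand is 0 when ∂_i f vanishes γ_n-almost everywhere. -/

import Mathlib

open MeasureTheory ProbabilityTheory
open scoped Classical

/-- The standard Gaussian probability measure `γₙ` on `ℝⁿ`. -/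
noncomputable def gauss (n : ℕ) : Measure (Fin n → ℝ) :=
  Measure.pi fun _ => gaussianReal 0 1

/-- Variance with respect to `γₙ`. -/
noncomputable def varG {n : ℕ} (f : (Fin n → ℝ) → ℝ) : ℝ :=
  (∫ x, f x ^ 2 ∂gauss n) - (∫ x, f x ∂gauss n) ^ 2

/-- `L¹(γₙ)`-norm. -/
noncomputable def gnorm1 {n : ℕ} (f : (Fin n → ℝ) → ℝ) : ℝ :=
  ∫ x, |f x| ∂gauss n

/-- `i`-th partial derivative of `f : ℝⁿ → ℝ`. -/
noncomputable def pd {n : ℕ} (i : Fin n) (f : (Fin n → ℝ) → ℝ) : (Fin n → ℝ) → ℝ :=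
  fun x => fderiv ℝ f x (Pi.single i 1)

section Gaussian

open scoped NNReal ENNReal

instance instIsProbabilityMeasureGauss (n : ℕ) : IsProbabilityMeasure (gauss n) := by
  unfold gauss; infer_instance

lemma gauss_eq_map_stdGaussian (n : ℕ) :
    gauss n = (stdGaussian (EuclideanSpace ℝ (Fin n))).map
      (PiLp.continuousLinearEquiv 2 ℝ (fun _ : Fin n => ℝ)) := by
  rw [← map_pi_eq_stdGaussian, Measure.map_map (by fun_prop) (by fun_prop)]
  exact Measure.map_id.symm

instance instIsGaussianGauss (n : ℕ) : IsGaussian (gauss n) := by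
  rw [gauss_eq_map_stdGaussian]
  infer_instance

lemma integral_id_gauss (n : ℕ) : (gauss n)[id] = 0 := by
  have := ((PiLp.continuousLinearEquiv 2 ℝ (fun _ : Fin n => ℝ)).integral_comp_comm
    (μ := stdGaussian (EuclideanSpace ℝ (Fin n))) id)
  rw [gauss_eq_map_stdGaussian, integral_map (by fun_prop) (by fun_prop)]
  simp only [id] at this ⊢
  rw [this, integral_id_stdGaussian, map_zero]

section Rotation

variable {E : Type*} [NormedAddCommGroup E] [NormedSpace ℝ E] [MeasurableSpace E] [BorelSpace E]
  [CompleteSpace E] [SecondCountableTopology E] {μ : Measure E} [IsGaussian μ]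

/-- A product of two copies of a centered Gaussian measure is invariant under rotations. -/
lemma measurePreserving_rotation (hμ : μ[id] = 0) {c s : ℝ}
    (h : c ^ 2 + s ^ 2 = 1) :
    MeasurePreserving (fun p : E × E => (c • p.1 + s • p.2, -s • p.1 + c • p.2))
      (μ.prod μ) (μ.prod μ) := by
  obtain ⟨θ, rfl, rfl⟩ : ∃ θ, Real.cos θ = c ∧ Real.sin θ = s := by
    have hn : ‖(⟨c, s⟩ : ℂ)‖ = 1 := by
      rw [← sq_eq_sq₀ (norm_nonneg _) zero_le_one, Complex.sq_norm, Complex.normSq_mk]; linarith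
    exact ⟨Complex.arg ⟨c, s⟩, by rw [Complex.cos_arg (by intro h0; simp [h0] at hn), hn]; simp,
      by rw [Complex.sin_arg, hn]; simp⟩
  refine ⟨by fun_prop, ?_⟩
  exact IsGaussian.map_rotation_eq_self hμ θ

lemma measurePreserving_add_smul (hμ : μ[id] = 0) {c s : ℝ}
    (h : c ^ 2 + s ^ 2 = 1) :
    MeasurePreserving (fun p : E × E => c • p.1 + s • p.2) (μ.prod μ) μ :=
  measurePreserving_fst.comp (measurePreserving_rotation hμ h)

/-- A product of two copies of a centered Gaussian measure is invariant under reflections. -/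
lemma measurePreserving_reflection (hμ : μ[id] = 0) {c s : ℝ}
    (h : c ^ 2 + s ^ 2 = 1) :
    MeasurePreserving (fun p : E × E => (c • p.1 + s • p.2, s • p.1 - c • p.2))
      (μ.prod μ) (μ.prod μ) := by
  have hneg : MeasurePreserving (fun x : E => -x) μ μ := by
    refine ⟨by fun_prop, ?_⟩
    have h1 := (measurePreserving_rotation hμ (c := -1) (s := 0) (by norm_num)).map_eq
    have h2 := congrArg (Measure.map Prod.fst) h1
    rw [Measure.map_map (by fun_prop) (by fun_prop), Measure.map_fst_prod] at h2
    have h3 : (Prod.fst ∘ fun p : E × E => ((-1 : ℝ) • p.1 + (0 : ℝ) • p.2,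
      -(0 : ℝ) • p.1 + (-1 : ℝ) • p.2)) = (fun x => -x) ∘ Prod.fst := by
      ext p; simp
    rw [h3, ← Measure.map_map (by fun_prop) (by fun_prop), Measure.map_fst_prod] at h2
    simpa using h2
  have := ((MeasurePreserving.id μ).prod hneg).comp (measurePreserving_rotation hμ h)
  convert this using 2 with p
  ext <;> simp [sub_eq_add_neg, add_comm]

end Rotation

section General

variable {α : Type*} {mα : MeasurableSpace α} {μ : Measure α}

lemma sq_integral_mul_le {f g : α → ℝ} (hf : Integrable (fun x => f x ^ 2) μ)
    (hg : Integrable (fun x => g x ^ 2) μ) (hfg : Integrable (fun x => f x * g x) μ) :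
    (∫ x, f x * g x ∂μ) ^ 2 ≤ (∫ x, f x ^ 2 ∂μ) * ∫ x, g x ^ 2 ∂μ := by
  have key : ∀ t : ℝ, 0 ≤ (∫ x, f x ^ 2 ∂μ) * (t * t) + (2 * ∫ x, f x * g x ∂μ) * t
      + ∫ x, g x ^ 2 ∂μ := by
    intro t
    have h : 0 ≤ ∫ x, (f x ^ 2 * (t * t) + 2 * (f x * g x) * t + g x ^ 2) ∂μ :=
      integral_nonneg fun x => by
        have := sq_nonneg (f x * t + g x)
        simp only [Pi.zero_apply]
        linarith
    have h1 : Integrable (fun x => f x ^ 2 * (t * t)) μ := hf.mul_const _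
    have h2 : Integrable (fun x => 2 * (f x * g x) * t) μ := (hfg.const_mul 2).mul_const t
    have h3 : Integrable (fun x => f x ^ 2 * (t * t) + 2 * (f x * g x) * t) μ := h1.add h2
    rwa [integral_add h3 hg, integral_add h1 h2, integral_mul_const, integral_mul_const,
      integral_const_mul] at h
  have := discrim_le_zero key
  unfold discrim at this
  linarith

lemma integral_sub_mul_add_const [IsProbabilityMeasure μ] {f g : α → ℝ} (hf : Integrable f μ)
    (hg : Integrable g μ) (a b : ℝ) :
    Integrable (fun x => f x - a * g x + b) μ ∧
      ∫ x, (f x - a * g x + b) ∂μ = (∫ x, f x ∂μ) - a * (∫ x, g x ∂μ) + b := by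
  have h1 : Integrable (fun x => f x - a * g x) μ := hf.sub (hg.const_mul a)
  refine ⟨h1.add (integrable_const b), ?_⟩
  rw [integral_add h1 (integrable_const b), integral_sub hf (hg.const_mul a), integral_const_mul]
  simp

lemma integral_comp_measurePreserving {β : Type*} {mβ : MeasurableSpace β} {ν : Measure β}
    {T : α → β} (hT : MeasurePreserving T μ ν) {f : β → ℝ} (hf : Measurable f) :
    ∫ x, f (T x) ∂μ = ∫ y, f y ∂ν := by
  rw [← hT.map_eq, integral_map hT.measurable.aemeasurable hf.aestronglyMeasurable]

lemma integrable_of_abs_le [IsFiniteMeasure μ] {f : α → ℝ} (hf : Measurable f) {B : ℝ}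
    (hB : ∀ x, |f x| ≤ B) : Integrable f μ :=
  Integrable.of_bound hf.aestronglyMeasurable B (ae_of_all _ hB)

end General

lemma gaussianPDFReal_standard (x : ℝ) :
    gaussianPDFReal 0 1 x = (√(2 * Real.pi))⁻¹ * Real.exp (-x ^ 2 / 2) := by
  simp [gaussianPDFReal]

lemma integrable_gaussianReal_iff {μ : ℝ} {v : ℝ≥0} (hv : v ≠ 0) {f : ℝ → ℝ} :
    Integrable f (gaussianReal μ v) ↔ Integrable (fun x => gaussianPDFReal μ v x * f x) := by
  rw [gaussianReal_of_var_ne_zero _ hv,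
    integrable_withDensity_iff_integrable_smul' (measurable_gaussianPDF _ _)
      (ae_of_all _ fun _ => gaussianPDF_lt_top)]
  simp [toReal_gaussianPDF]

lemma integral_gaussianReal_of_pdf_eq {f : ℝ → ℝ} {K m : ℝ} {v : ℝ≥0} (hv : v ≠ 0)
    (h : ∀ x, gaussianPDFReal 0 1 x * f x = K * gaussianPDFReal m v x) :
    Integrable f (gaussianReal 0 1) ∧ ∫ x, f x ∂gaussianReal 0 1 = K := by
  rw [integrable_gaussianReal_iff one_ne_zero, integral_gaussianReal_eq_integral_smul one_ne_zero]
  simp only [smul_eq_mul, h]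
  refine ⟨(integrable_gaussianPDFReal m v).const_mul K, ?_⟩
  rw [integral_const_mul, integral_gaussianPDFReal_eq_one _ hv, mul_one]

lemma integral_exp_mul_sq_gaussianReal {l : ℝ} (hl : l < 1 / 2) :
    Integrable (fun x => Real.exp (l * x ^ 2)) (gaussianReal 0 1) ∧
      ∫ x, Real.exp (l * x ^ 2) ∂gaussianReal 0 1 = (√(1 - 2 * l))⁻¹ := by
  have ha : 0 < 1 - 2 * l := by linarith
  refine integral_gaussianReal_of_pdf_eq (m := 0) (v := (1 - 2 * l)⁻¹.toNNReal)
    (Real.toNNReal_pos.2 (inv_pos.2 ha)).ne' fun x => ?_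
  rw [gaussianPDFReal_standard, gaussianPDFReal_def, Real.coe_toNNReal _ (by positivity), mul_assoc,
    ← Real.exp_add,
    Real.sqrt_mul (show (0 : ℝ) ≤ 2 * Real.pi by positivity) (1 - 2 * l)⁻¹, Real.sqrt_inv]
  have : √(1 - 2 * l) ≠ 0 := (Real.sqrt_pos.2 ha).ne'
  field_simp
  congr 1
  ring

/-- The Mehler kernel at correlation `5 / 13`, as a density with respect to the standard
Gaussian measure. -/
noncomputable def mehlerKernel (x y : ℝ) : ℝ :=
  gaussianPDFReal (5 / 13 * x) (144 / 169) y / gaussianPDFReal 0 1 y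

lemma mehlerKernel_eq (x y : ℝ) : mehlerKernel x y =
    13 / 12 * Real.exp (-(y - 5 / 13 * x) ^ 2 / (2 * (144 / 169)) + y ^ 2 / 2) := by
  have h1 : √(2 * Real.pi * (144 / 169)) = √(2 * Real.pi) * (12 / 13) := by
    rw [Real.sqrt_mul (by positivity), show (144 / 169 : ℝ) = (12 / 13) ^ 2 by norm_num,
      Real.sqrt_sq (by norm_num)]
  have h2 : √(2 * Real.pi) ≠ 0 := by positivity
  rw [mehlerKernel, gaussianPDFReal_standard, gaussianPDFReal, Real.exp_add,
    show -y ^ 2 / 2 = -(y ^ 2 / 2) by ring, Real.exp_neg]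
  push_cast
  rw [h1]
  field_simp

lemma measurable_mehlerKernel (x : ℝ) : Measurable (mehlerKernel x) :=
  (measurable_gaussianPDFReal _ _).div (measurable_gaussianPDFReal _ _)

lemma integral_mehlerKernel_mul (x : ℝ) (g : ℝ → ℝ) :
    ∫ y, mehlerKernel x y * g y ∂gaussianReal 0 1 =
      ∫ y, g y ∂gaussianReal (5 / 13 * x) (144 / 169) := by
  rw [integral_gaussianReal_eq_integral_smul one_ne_zero,
    integral_gaussianReal_eq_integral_smul (by positivity)]
  refine integral_congr_ae (ae_of_all _ fun y => ?_)
  have := (gaussianPDFReal_pos 0 1 y one_ne_zero).ne'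
  simp only [mehlerKernel, smul_eq_mul]
  field_simp

lemma integral_sq_mehlerKernel (x : ℝ) :
    Integrable (fun y => mehlerKernel x y ^ 2) (gaussianReal 0 1) ∧
      ∫ y, mehlerKernel x y ^ 2 ∂gaussianReal 0 1 =
        √(28561 / 27936) * Real.exp (25 / 194 * x ^ 2) := by
  refine integral_gaussianReal_of_pdf_eq (m := 65 / 97 * x) (v := 72 / 97) (by positivity)
    fun y => ?_
  have h2 : √(2 * Real.pi) ≠ 0 := by positivity
  have h3 : √(28561 / 27936) * (√(72 / 97))⁻¹ = (13 / 12) ^ 2 := by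
    rw [← Real.sqrt_inv, ← Real.sqrt_mul (by norm_num), Real.sqrt_eq_iff_mul_self_eq] <;> norm_num
  rw [gaussianPDFReal_standard, gaussianPDFReal, mehlerKernel_eq]
  push_cast
  rw [Real.sqrt_mul (show (0 : ℝ) ≤ 2 * Real.pi by positivity) (72 / 97), mul_inv, mul_pow, ← h3,
    ← Real.exp_nat_mul]
  have : ∀ a b c d e f g : ℝ, c + d = f + g → a * Real.exp c * (b * e * Real.exp d) =
      b * Real.exp f * (a * e * Real.exp g) := by
    intro a b c d e f g h
    have : Real.exp c * Real.exp d = Real.exp f * Real.exp g := by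
      rw [← Real.exp_add, h, Real.exp_add]
    linear_combination a * b * e * this
  apply this
  push_cast
  ring

lemma integrable_mehlerKernel (x : ℝ) :
    Integrable (mehlerKernel x) (gaussianReal 0 1) := by
  refine ((integral_sq_mehlerKernel x).1.add (integrable_const 1)).mono'
    (measurable_mehlerKernel x).aestronglyMeasurable (ae_of_all _ fun y => ?_)
  rw [Real.norm_eq_abs, Pi.add_apply, abs_le]
  constructor <;> nlinarith [sq_nonneg (mehlerKernel x y - 1), sq_nonneg (mehlerKernel x y + 1)]

lemma sq_integral_gaussianReal_sub_le {g : ℝ → ℝ} (hg : Measurable g) {B : ℝ}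
    (hB : ∀ x, |g x| ≤ B) (x : ℝ) :
    ((∫ y, g y ∂gaussianReal (5 / 13 * x) (144 / 169)) - ∫ y, g y ∂gaussianReal 0 1) ^ 2 ≤
      ((∫ y, g y ^ 2 ∂gaussianReal 0 1) - (∫ y, g y ∂gaussianReal 0 1) ^ 2) *
        (√(28561 / 27936) * Real.exp (25 / 194 * x ^ 2) - 1) := by
  set γ := gaussianReal 0 1
  set c := ∫ y, g y ∂γ
  have hgi : Integrable g γ := integrable_of_abs_le hg hB
  have hg2 : Integrable (fun y => g y ^ 2) γ := by
    refine integrable_of_abs_le (hg.pow_const 2) (B := B ^ 2) fun x => ?_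
    rw [abs_pow]
    exact pow_le_pow_left₀ (abs_nonneg _) (hB x) 2
  have hk := integrable_mehlerKernel x
  obtain ⟨hk2, hk2e⟩ := integral_sq_mehlerKernel x
  have hk1 : ∫ y, mehlerKernel x y ∂γ = 1 := by
    simpa using integral_mehlerKernel_mul x fun _ => 1
  have hkg : Integrable (fun y => mehlerKernel x y * g y) γ :=
    hk.mul_bdd (c := B) hg.aestronglyMeasurable (ae_of_all _ hB)
  have hkg1 : Integrable (fun y => mehlerKernel x y * g y - g y) γ := hkg.sub hgi
  have hg_sq : (fun y => (g y - c) ^ 2) = fun y => g y ^ 2 - 2 * c * g y + c ^ 2 := by ext; ring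
  have hk_sq : (fun y => (mehlerKernel x y - 1) ^ 2) =
    fun y => mehlerKernel x y ^ 2 - 2 * mehlerKernel x y + 1 := by ext; ring
  have hgk : (fun y => (g y - c) * (mehlerKernel x y - 1)) =
    fun y => mehlerKernel x y * g y - g y - c * mehlerKernel x y + c := by ext; ring
  obtain ⟨i1, e1⟩ := integral_sub_mul_add_const hg2 hgi (2 * c) (c ^ 2)
  obtain ⟨i2, e2⟩ := integral_sub_mul_add_const hk2 hk 2 1
  obtain ⟨i3, e3⟩ := integral_sub_mul_add_const hkg1 hk c c
  rw [← hg_sq] at i1 e1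
  rw [← hk_sq, hk1, hk2e] at e2
  rw [← hk_sq] at i2
  rw [← hgk, hk1, integral_sub hkg hgi, integral_mehlerKernel_mul] at e3
  rw [← hgk] at i3
  have := sq_integral_mul_le i1 i2 i3
  rw [e1, e2, e3] at this
  change (_ - c - c * 1 + c) ^ 2 ≤ (_ - 2 * c * c + c ^ 2) * _ at this
  calc _ = _ := by ring
    _ ≤ _ := this
    _ = _ := by ring

lemma integral_affine_gaussianReal (g : ℝ → ℝ) (hg : Measurable g) (x : ℝ) :
    ∫ z, g (5 / 13 * x + 12 / 13 * z) ∂gaussianReal 0 1 =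
      ∫ y, g y ∂gaussianReal (5 / 13 * x) (144 / 169) := by
  have h : (gaussianReal 0 1).map (fun z => 5 / 13 * x + 12 / 13 * z) =
      gaussianReal (5 / 13 * x) (144 / 169) := by
    have := gaussianReal_map_const_add (μ := 0) (v := 144 / 169) (5 / 13 * x)
    rw [zero_add] at this
    rw [← this]
    have h2 := gaussianReal_map_const_mul (μ := 0) (v := 1) (12 / 13)
    have h3 : (NNReal.mk ((12 / 13) ^ 2) (sq_nonneg _)) * 1 = 144 / 169 := by
      rw [mul_one]; apply NNReal.eq; rw [NNReal.coe_mk]; push_cast; norm_num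
    rw [mul_zero, h3] at h2
    rw [← h2, Measure.map_map (by fun_prop) (by fun_prop)]
    rfl
  rw [← h, integral_map (by fun_prop) hg.aestronglyMeasurable]

/-- Hypercontractivity from `L²` to `L⁴` of the one-dimensional Ornstein–Uhlenbeck operator. -/
lemma integral_pow_four_le {g : ℝ → ℝ} (hg : Measurable g) {B : ℝ} (hB : ∀ x, |g x| ≤ B) :
    ∫ x, (∫ z, g (5 / 13 * x + 12 / 13 * z) ∂gaussianReal 0 1) ^ 4 ∂gaussianReal 0 1 ≤
      (∫ x, g x ^ 2 ∂gaussianReal 0 1) ^ 2 := by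
  set γ := gaussianReal 0 1
  set c := ∫ y, g y ∂γ with hc
  set A := ∫ y, g y ^ 2 ∂γ
  set P : ℝ → ℝ := fun x => ∫ z, g (5 / 13 * x + 12 / 13 * z) ∂γ with hP
  set Q : ℝ → ℝ := fun x => √(28561 / 27936) * Real.exp (25 / 194 * x ^ 2) - 1 with hQ
  have hw : ∀ x, (P x - c) ^ 2 ≤ (A - c ^ 2) * Q x := fun x => by
    have := sq_integral_gaussianReal_sub_le hg hB x
    rwa [← integral_affine_gaussianReal g hg] at this
  have hPm : Measurable P :=
    (StronglyMeasurable.integral_prod_right (ν := γ)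
      (f := fun x z => g (5 / 13 * x + 12 / 13 * z))
      (by apply Measurable.stronglyMeasurable; fun_prop)).measurable
  have hPB : ∀ x, |P x| ≤ B := fun x => by
    have := norm_integral_le_of_norm_le_const (μ := γ) (f := fun z => g (5 / 13 * x + 12 / 13 * z))
      (C := B) (ae_of_all _ fun z => hB _)
    simpa using this
  have hPi : Integrable P γ := integrable_of_abs_le hPm hPB
  have hPc : ∫ x, P x ∂γ = c := by
    have mp := measurePreserving_add_smul (μ := γ) (by simp [γ]) (c := 5 / 13) (s := 12 / 13)
      (by norm_num)
    have h1 : ∫ p, g ((5 / 13 : ℝ) • p.1 + (12 / 13 : ℝ) • p.2) ∂(γ.prod γ) = c := by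
      exact integral_comp_measurePreserving mp hg
    rw [← h1, integral_prod]
    · simp [hP]
    · exact integrable_of_abs_le (by fun_prop) fun p => hB _
  have hAc : 0 ≤ A - c ^ 2 := by
    have := sq_integral_mul_le (μ := γ) (f := g) (g := fun _ => 1)
      (integrable_of_abs_le (hg.pow_const 2) (B := B ^ 2) fun x => by
        rw [abs_pow]; exact pow_le_pow_left₀ (abs_nonneg _) (hB x) 2)
      (integrable_const _) (by simpa using integrable_of_abs_le hg hB)
    simp at this
    linarith
  obtain ⟨i1, e1⟩ := integral_exp_mul_sq_gaussianReal (l := 25 / 194) (by norm_num)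
  obtain ⟨i2, e2⟩ := integral_exp_mul_sq_gaussianReal (l := 2 * (25 / 194)) (by norm_num)
  have iQ : Integrable Q γ := (i1.const_mul _).sub (integrable_const 1)
  have eQ : ∫ x, Q x ∂γ = 25 / 144 := by
    rw [hQ, integral_sub (i1.const_mul _) (integrable_const 1), integral_const_mul, e1,
      ← Real.sqrt_inv, ← Real.sqrt_mul (by norm_num)]
    have : √(28561 / 27936 * (1 - 2 * (25 / 194))⁻¹) = 169 / 144 := by
      rw [Real.sqrt_eq_iff_mul_self_eq] <;> norm_num
    rw [this]
    simp; norm_num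
  have hQ2 : (fun x => Q x ^ 2) = fun x =>
      28561 / 27936 * Real.exp (2 * (25 / 194) * x ^ 2) - 2 * Q x + (-1) := by
    ext x
    have : Real.exp (2 * (25 / 194) * x ^ 2) = Real.exp (25 / 194 * x ^ 2) ^ 2 := by
      rw [← Real.exp_nat_mul]; congr 1; push_cast; ring
    simp only [hQ, this]
    have hs : √(28561 / 27936) ^ 2 = (28561 / 27936 : ℝ) := Real.sq_sqrt (by norm_num)
    linear_combination Real.exp (25 / 194 * x ^ 2) ^ 2 * hs
  obtain ⟨iQ2, eQ2⟩ := integral_sub_mul_add_const (i2.const_mul (28561 / 27936)) iQ 2 (-1)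
  rw [← hQ2, integral_const_mul, e2, eQ] at eQ2
  rw [← hQ2] at iQ2
  have eQ2' : ∫ x, Q x ^ 2 ∂γ ≤ 1 / 3 := by
    have : (√(1 - 2 * (2 * (25 / 194))))⁻¹ ≤ (1.44 : ℝ) := by
      rw [← Real.sqrt_inv, Real.sqrt_le_left (by norm_num)]; norm_num
    rw [eQ2]
    linarith
  set D := A - c ^ 2
  have hpt : ∀ x, P x ^ 4 ≤ (3 * D ^ 2) * Q x ^ 2 - -(8 * c ^ 2 * D) * Q x + 0 +
      (4 * c ^ 3 * P x - 3 * c ^ 4) := fun x => by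
    have h1 := hw x
    have h2 : ((P x - c) ^ 2) ^ 2 ≤ (D * Q x) ^ 2 := pow_le_pow_left₀ (sq_nonneg _) h1 2
    have h3 : 0 ≤ c ^ 2 * (D * Q x - (P x - c) ^ 2) :=
      mul_nonneg (sq_nonneg _) (sub_nonneg.2 h1)
    nlinarith [sq_nonneg ((P x - c) * (c - (P x - c)))]
  have iP : Integrable (fun x => 4 * c ^ 3 * P x - 3 * c ^ 4) γ :=
    (hPi.const_mul _).sub (integrable_const _)
  obtain ⟨i4, e4⟩ := integral_sub_mul_add_const (iQ2.const_mul (3 * D ^ 2)) iQ (-(8 * c ^ 2 * D)) 0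
  calc ∫ x, P x ^ 4 ∂γ ≤ ∫ x, ((3 * D ^ 2) * Q x ^ 2 - -(8 * c ^ 2 * D) * Q x + 0 +
      (4 * c ^ 3 * P x - 3 * c ^ 4)) ∂γ := by
        refine integral_mono (integrable_of_abs_le (hPm.pow_const 4) (B := B ^ 4) fun x => ?_)
          (i4.add iP) hpt
        rw [abs_pow]; exact pow_le_pow_left₀ (abs_nonneg _) (hPB x) 4
    _ = 3 * D ^ 2 * (∫ x, Q x ^ 2 ∂γ) + 8 * c ^ 2 * D * (25 / 144) + c ^ 4 := by
        rw [integral_add i4 iP, e4, eQ, integral_const_mul,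
          integral_sub (hPi.const_mul _) (integrable_const _), integral_const_mul, hPc]
        simp
        ring
    _ ≤ A ^ 2 := by
        have h1 : 3 * D ^ 2 * (∫ x, Q x ^ 2 ∂γ) ≤ 3 * D ^ 2 * (1 / 3) := by gcongr
        have h2 : A = D + c ^ 2 := by ring
        rw [h2]
        nlinarith [mul_nonneg (sq_nonneg c) hAc]

lemma lintegral_pow_four_le {G : ℝ → ℝ≥0∞} (hG : Measurable G) {B : ℝ≥0} (hB : ∀ x, G x ≤ B) :
    ∫⁻ x, (∫⁻ z, G (5 / 13 * x + 12 / 13 * z) ∂gaussianReal 0 1) ^ 4 ∂gaussianReal 0 1 ≤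
      (∫⁻ x, G x ^ 2 ∂gaussianReal 0 1) ^ 2 := by
  have hG' : ∀ x, G x = ENNReal.ofReal (G x).toReal := fun x =>
    (ENNReal.ofReal_toReal ((hB x).trans_lt ENNReal.coe_lt_top).ne).symm
  obtain ⟨g, hgG, hg, hg0, hgB⟩ : ∃ g : ℝ → ℝ, (∀ x, G x = ENNReal.ofReal (g x)) ∧ Measurable g ∧
      (∀ x, 0 ≤ g x) ∧ ∀ x, |g x| ≤ B :=
    ⟨fun x => (G x).toReal, hG', hG.ennreal_toReal, fun x => ENNReal.toReal_nonneg, fun x => by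
      rw [abs_of_nonneg ENNReal.toReal_nonneg]
      exact ENNReal.toReal_le_coe_of_le_coe (hB x)⟩
  have hPB : ∀ x, |∫ z, g (5 / 13 * x + 12 / 13 * z) ∂gaussianReal 0 1| ≤ B := fun x => by
    have := norm_integral_le_of_norm_le_const (μ := gaussianReal 0 1)
      (f := fun z => g (5 / 13 * x + 12 / 13 * z)) (C := B) (ae_of_all _ fun z => hgB _)
    simpa using this
  have hPm : Measurable fun x => ∫ z, g (5 / 13 * x + 12 / 13 * z) ∂gaussianReal 0 1 :=
    (StronglyMeasurable.integral_prod_right (ν := gaussianReal 0 1)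
      (f := fun x z => g (5 / 13 * x + 12 / 13 * z))
      (by apply Measurable.stronglyMeasurable; fun_prop)).measurable
  simp_rw [hgG]
  have h1 : ∀ x, ∫⁻ z, ENNReal.ofReal (g (5 / 13 * x + 12 / 13 * z)) ∂gaussianReal 0 1 =
      ENNReal.ofReal (∫ z, g (5 / 13 * x + 12 / 13 * z) ∂gaussianReal 0 1) := fun x =>
    (ofReal_integral_eq_lintegral_ofReal (integrable_of_abs_le (by fun_prop) fun z => hgB _)
      (ae_of_all _ fun z => hg0 _)).symm
  have h0 : ∀ x, 0 ≤ ∫ z, g (5 / 13 * x + 12 / 13 * z) ∂gaussianReal 0 1 := fun x =>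
    integral_nonneg fun z => hg0 _
  simp_rw [h1, ← ENNReal.ofReal_pow (h0 _), ← ENNReal.ofReal_pow (hg0 _)]
  rw [← ofReal_integral_eq_lintegral_ofReal (integrable_of_abs_le (hPm.pow_const 4)
      (B := (B : ℝ) ^ 4) fun x => by
        rw [abs_pow]; exact pow_le_pow_left₀ (abs_nonneg _) (hPB x) 4)
      (ae_of_all _ fun x => pow_nonneg (h0 x) 4),
    ← ofReal_integral_eq_lintegral_ofReal (integrable_of_abs_le (hg.pow_const 2)
      (B := (B : ℝ) ^ 2) fun x => by
        rw [abs_pow]; exact pow_le_pow_left₀ (abs_nonneg _) (hgB x) 2)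
      (ae_of_all _ fun x => sq_nonneg _),
    ← ENNReal.ofReal_pow (integral_nonneg fun x => sq_nonneg _)]
  exact ENNReal.ofReal_le_ofReal (integral_pow_four_le hg hgB)

lemma lintegral_rpow_mul_rpow_gaussianReal_le {U V : ℝ → ℝ≥0∞} (hU : Measurable U)
    (hV : Measurable V) {B : ℝ≥0} (hB : ∀ x, V x ≤ B) :
    ∫⁻ x, ∫⁻ z, U x ^ (3 / 4 : ℝ) * V (5 / 13 * x + 12 / 13 * z) ^ (1 / 2 : ℝ)
        ∂gaussianReal 0 1 ∂gaussianReal 0 1 ≤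
      (∫⁻ x, U x ∂gaussianReal 0 1) ^ (3 / 4 : ℝ) *
        (∫⁻ x, V x ∂gaussianReal 0 1) ^ (1 / 2 : ℝ) := by
  set γ := gaussianReal 0 1
  have h1 : ∀ x, ∫⁻ z, U x ^ (3 / 4 : ℝ) * V (5 / 13 * x + 12 / 13 * z) ^ (1 / 2 : ℝ) ∂γ =
      U x ^ (3 / 4 : ℝ) * ∫⁻ z, V (5 / 13 * x + 12 / 13 * z) ^ (1 / 2 : ℝ) ∂γ := fun x =>
    lintegral_const_mul _ (by fun_prop)
  simp_rw [h1]
  have hm : Measurable fun x => ∫⁻ z, V (5 / 13 * x + 12 / 13 * z) ^ (1 / 2 : ℝ) ∂γ :=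
    Measurable.lintegral_prod_right' (f := fun p : ℝ × ℝ =>
      V (5 / 13 * p.1 + 12 / 13 * p.2) ^ (1 / 2 : ℝ)) (by fun_prop)
  refine (ENNReal.lintegral_mul_le_Lp_mul_Lq γ (p := 4 / 3) (q := 4)
    (by rw [Real.holderConjugate_iff]; norm_num)
    (hU.pow_const _).aemeasurable hm.aemeasurable).trans ?_
  have h4 := lintegral_pow_four_le (hV.pow_const (1 / 2 : ℝ)) (B := B ^ (1 / 2 : ℝ)) fun x => by
    rw [ENNReal.coe_rpow_of_nonneg _ (by norm_num)]
    exact ENNReal.rpow_le_rpow (hB x) (by norm_num)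
  have e1 : ∀ x, (U x ^ (3 / 4 : ℝ)) ^ (4 / 3 : ℝ) = U x := fun x => by
    rw [← ENNReal.rpow_mul]; norm_num
  have e2 : ∀ x, (V x ^ (1 / 2 : ℝ)) ^ 2 = V x := fun x => by
    rw [← ENNReal.rpow_natCast, ← ENNReal.rpow_mul]; norm_num
  simp_rw [e2] at h4
  simp_rw [e1]
  rw [show (1 / (4 / 3) : ℝ) = 3 / 4 by norm_num]
  gcongr
  calc _ ≤ ((∫⁻ x, V x ∂γ) ^ 2) ^ (1 / 4 : ℝ) := by
        refine ENNReal.rpow_le_rpow (le_trans (le_of_eq ?_) h4) (by norm_num)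
        refine lintegral_congr fun x => ?_
        rw [← ENNReal.rpow_natCast]; norm_num; rfl
    _ = _ := by rw [← ENNReal.rpow_natCast, ← ENNReal.rpow_mul]; norm_num

lemma lintegral_gauss_succ {n : ℕ} {F : (Fin (n + 1) → ℝ) → ℝ≥0∞} (hF : Measurable F) :
    ∫⁻ x, F x ∂gauss (n + 1) =
      ∫⁻ t, ∫⁻ y, F (Fin.cons t y) ∂gauss n ∂gaussianReal 0 1 := by
  have h := (measurePreserving_piFinSuccAbove (fun _ : Fin (n + 1) => gaussianReal 0 1) 0).symm
  have h' := h.lintegral_comp hF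
  rw [gauss, ← h', lintegral_prod _ (by fun_prop)]
  simp [gauss, MeasurableEquiv.piFinSuccAbove_symm_apply, Fin.insertNthEquiv]

/-- Hypercontractivity of the Ornstein–Uhlenbeck operator on `ℝⁿ`, in bilinear form. -/
lemma lintegral_rpow_mul_rpow_gauss_le {n : ℕ} {U V : (Fin n → ℝ) → ℝ≥0∞} (hU : Measurable U)
    (hV : Measurable V) {B : ℝ≥0} (hB : ∀ x, V x ≤ B) :
    ∫⁻ x, ∫⁻ z, U x ^ (3 / 4 : ℝ) * V ((5 / 13 : ℝ) • x + (12 / 13 : ℝ) • z) ^ (1 / 2 : ℝ)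
        ∂gauss n ∂gauss n ≤
      (∫⁻ x, U x ∂gauss n) ^ (3 / 4 : ℝ) * (∫⁻ x, V x ∂gauss n) ^ (1 / 2 : ℝ) := by
  induction n with
  | zero =>
    have h : gauss 0 = Measure.dirac default := by
      rw [gauss, Measure.pi_of_empty _ default]
    have hx : ∀ x : Fin 0 → ℝ, x = default := fun x => Subsingleton.elim _ _
    rw [h]
    simp only [lintegral_dirac]
    rw [hx ((5 / 13 : ℝ) • _ + _)]
  | succ n ih =>
    have hcons : Measurable fun p : ℝ × (Fin n → ℝ) => (Fin.cons p.1 p.2 : Fin (n + 1) → ℝ) := by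
      refine measurable_pi_iff.2 fun i => ?_
      refine Fin.cases ?_ (fun j => ?_) i
      · exact measurable_fst
      · exact (measurable_pi_apply j).comp measurable_snd
    have hcomb : ∀ (a b : ℝ) (x z : Fin n → ℝ),
        (5 / 13 : ℝ) • (Fin.cons a x : Fin (n + 1) → ℝ) + (12 / 13 : ℝ) • Fin.cons b z =
          Fin.cons (5 / 13 * a + 12 / 13 * b) ((5 / 13 : ℝ) • x + (12 / 13 : ℝ) • z) := by
      intro a b x z
      ext i
      refine Fin.cases ?_ (fun j => ?_) i <;> simp
    have hUc : Measurable fun p : ℝ × (Fin n → ℝ) => U (Fin.cons p.1 p.2) := hU.comp hcons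
    have hVc : Measurable fun p : ℝ × (Fin n → ℝ) => V (Fin.cons p.1 p.2) := hV.comp hcons
    have hV2 : Measurable fun q : (ℝ × (Fin n → ℝ)) × (ℝ × (Fin n → ℝ)) =>
        V (Fin.cons (5 / 13 * q.1.1 + 12 / 13 * q.2.1)
          ((5 / 13 : ℝ) • q.1.2 + (12 / 13 : ℝ) • q.2.2)) :=
      hVc.comp (f := fun q : (ℝ × (Fin n → ℝ)) × (ℝ × (Fin n → ℝ)) =>
        (5 / 13 * q.1.1 + 12 / 13 * q.2.1, (5 / 13 : ℝ) • q.1.2 + (12 / 13 : ℝ) • q.2.2))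
        (by fun_prop)
    set U' : ℝ → ℝ≥0∞ := fun a => ∫⁻ x, U (Fin.cons a x) ∂gauss n
    set V' : ℝ → ℝ≥0∞ := fun a => ∫⁻ x, V (Fin.cons a x) ∂gauss n
    have hU' : Measurable U' := hUc.lintegral_prod_right'
    have hV' : Measurable V' := hVc.lintegral_prod_right'
    have hVB : ∀ a, V' a ≤ B := fun a =>
      (lintegral_mono fun x => hB _).trans (by simp)
    have hint : Measurable fun q : (ℝ × (Fin n → ℝ)) × (ℝ × (Fin n → ℝ)) =>
        U (Fin.cons q.1.1 q.1.2) ^ (3 / 4 : ℝ) * V (Fin.cons (5 / 13 * q.1.1 + 12 / 13 * q.2.1)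
          ((5 / 13 : ℝ) • q.1.2 + (12 / 13 : ℝ) • q.2.2)) ^ (1 / 2 : ℝ) :=
      ((hUc.comp measurable_fst).pow_const _).mul (hV2.pow_const _)
    have hz : ∀ x : Fin (n + 1) → ℝ, ∫⁻ z, U x ^ (3 / 4 : ℝ) *
        V ((5 / 13 : ℝ) • x + (12 / 13 : ℝ) • z) ^ (1 / 2 : ℝ) ∂gauss (n + 1) =
        ∫⁻ b, ∫⁻ z, U x ^ (3 / 4 : ℝ) *
          V ((5 / 13 : ℝ) • x + (12 / 13 : ℝ) • (Fin.cons b z : Fin (n + 1) → ℝ)) ^ (1 / 2 : ℝ)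
          ∂gauss n ∂gaussianReal 0 1 := fun x => lintegral_gauss_succ (by fun_prop)
    have hm : Measurable fun x : Fin (n + 1) → ℝ => ∫⁻ z, U x ^ (3 / 4 : ℝ) *
        V ((5 / 13 : ℝ) • x + (12 / 13 : ℝ) • z) ^ (1 / 2 : ℝ) ∂gauss (n + 1) :=
      Measurable.lintegral_prod_right' (f := fun p : (Fin (n + 1) → ℝ) × (Fin (n + 1) → ℝ) =>
        U p.1 ^ (3 / 4 : ℝ) * V ((5 / 13 : ℝ) • p.1 + (12 / 13 : ℝ) • p.2) ^ (1 / 2 : ℝ))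
        (by fun_prop)
    rw [lintegral_gauss_succ hm, lintegral_gauss_succ hU, lintegral_gauss_succ hV]
    simp_rw [hz, hcomb]
    calc _ = ∫⁻ a, ∫⁻ b, ∫⁻ x, ∫⁻ z, U (Fin.cons a x) ^ (3 / 4 : ℝ) *
          V (Fin.cons (5 / 13 * a + 12 / 13 * b) ((5 / 13 : ℝ) • x + (12 / 13 : ℝ) • z))
            ^ (1 / 2 : ℝ) ∂gauss n ∂gauss n ∂gaussianReal 0 1 ∂gaussianReal 0 1 := by
          refine lintegral_congr fun a => lintegral_lintegral_swap ?_
          refine Measurable.aemeasurable ?_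
          exact Measurable.lintegral_prod_right' (f := fun p : ((Fin n → ℝ) × ℝ) × (Fin n → ℝ) =>
            U (Fin.cons a p.1.1) ^ (3 / 4 : ℝ) * V (Fin.cons (5 / 13 * a + 12 / 13 * p.1.2)
              ((5 / 13 : ℝ) • p.1.1 + (12 / 13 : ℝ) • p.2)) ^ (1 / 2 : ℝ))
            (hint.comp (f := fun p : ((Fin n → ℝ) × ℝ) × (Fin n → ℝ) =>
              ((a, p.1.1), (p.1.2, p.2))) (by fun_prop))
      _ ≤ ∫⁻ a, ∫⁻ b, U' a ^ (3 / 4 : ℝ) * V' (5 / 13 * a + 12 / 13 * b) ^ (1 / 2 : ℝ)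
            ∂gaussianReal 0 1 ∂gaussianReal 0 1 := by
          refine lintegral_mono fun a => lintegral_mono fun b => ?_
          exact ih (U := fun x => U (Fin.cons a x))
            (V := fun x => V (Fin.cons (5 / 13 * a + 12 / 13 * b) x))
            (hUc.comp measurable_prodMk_left) (hVc.comp measurable_prodMk_left) fun x => hB _
      _ ≤ _ := lintegral_rpow_mul_rpow_gaussianReal_le hU' hV' hVB

/-- The Ornstein–Uhlenbeck operator, given by Mehler's formula. -/
noncomputable def ou {n : ℕ} (ρ : ℝ) (f : (Fin n → ℝ) → ℝ) (x : Fin n → ℝ) : ℝ :=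
  ∫ z, f (ρ • x + √(1 - ρ ^ 2) • z) ∂gauss n

section OrnsteinUhlenbeck

variable {n : ℕ} {f g : (Fin n → ℝ) → ℝ} {A B ρ : ℝ}

lemma sq_add_sq_sqrt_one_sub_sq (hρ0 : 0 ≤ ρ) (hρ1 : ρ ≤ 1) :
    ρ ^ 2 + √(1 - ρ ^ 2) ^ 2 = 1 := by
  rw [Real.sq_sqrt (by nlinarith)]; ring

lemma measurable_ou (hf : Measurable f) (ρ : ℝ) : Measurable (ou ρ f) :=
  (StronglyMeasurable.integral_prod_right (ν := gauss n)
    (f := fun x z => f (ρ • x + √(1 - ρ ^ 2) • z))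
    (by apply Measurable.stronglyMeasurable; fun_prop)).measurable

lemma abs_ou_le (hB : ∀ x, |f x| ≤ B) (ρ : ℝ) (x : Fin n → ℝ) : |ou ρ f x| ≤ B := by
  have := norm_integral_le_of_norm_le_const (μ := gauss n)
    (f := fun z => f (ρ • x + √(1 - ρ ^ 2) • z)) (C := B) (ae_of_all _ fun z => hB _)
  simpa [ou] using this

lemma abs_mul_le_mul {x y : ℝ} (hx : |x| ≤ A) (hy : |y| ≤ B) : |x * y| ≤ A * B := by
  rw [abs_mul]
  exact mul_le_mul hx hy (abs_nonneg _) ((abs_nonneg _).trans hx)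

lemma integral_mul_ou (hf : Measurable f) (hfB : ∀ x, |f x| ≤ B) (hg : Measurable g)
    (hgA : ∀ x, |g x| ≤ A) (ρ : ℝ) :
    ∫ x, g x * ou ρ f x ∂gauss n =
      ∫ p, g p.1 * f (ρ • p.1 + √(1 - ρ ^ 2) • p.2) ∂(gauss n).prod (gauss n) := by
  rw [integral_prod _ (integrable_of_abs_le (by fun_prop) fun p => abs_mul_le_mul (hgA _) (hfB _))]
  simp only [integral_const_mul, ou]

/-- The Ornstein–Uhlenbeck operators are self-adjoint. -/
lemma integral_mul_ou_comm (hf : Measurable f) (hfB : ∀ x, |f x| ≤ B) (hg : Measurable g)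
    (hgA : ∀ x, |g x| ≤ A) (hρ0 : 0 ≤ ρ) (hρ1 : ρ ≤ 1) :
    ∫ x, g x * ou ρ f x ∂gauss n = ∫ x, f x * ou ρ g x ∂gauss n := by
  rw [integral_mul_ou hf hfB hg hgA, integral_mul_ou hg hgA hf hfB]
  have hs := sq_add_sq_sqrt_one_sub_sq hρ0 hρ1
  rw [← integral_comp_measurePreserving
    (measurePreserving_reflection (integral_id_gauss n) hs) (by fun_prop)]
  refine integral_congr_ae (ae_of_all _ fun p => ?_)
  have : ρ • (ρ • p.1 + √(1 - ρ ^ 2) • p.2) +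
      √(1 - ρ ^ 2) • (√(1 - ρ ^ 2) • p.1 - ρ • p.2) = p.1 := by
    have : p.1 = (ρ ^ 2 + √(1 - ρ ^ 2) ^ 2) • p.1 := by rw [hs, one_smul]
    conv_rhs => rw [this]
    module
  simp only [this]
  ring

lemma integral_abs_ou_le (hf : Measurable f) (hfB : ∀ x, |f x| ≤ B) (hρ0 : 0 ≤ ρ) (hρ1 : ρ ≤ 1) :
    ∫ x, |ou ρ f x| ∂gauss n ≤ ∫ x, |f x| ∂gauss n := by
  have hs := sq_add_sq_sqrt_one_sub_sq hρ0 hρ1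
  rw [← integral_comp_measurePreserving (f := fun x => |f x|)
    (measurePreserving_add_smul (integral_id_gauss n) hs) (by fun_prop),
    integral_prod _ (integrable_of_abs_le (B := B) (by fun_prop) fun p => by
      rw [abs_abs]; exact hfB _)]
  refine integral_mono (integrable_of_abs_le (B := B) (measurable_ou hf ρ).abs fun x => by
    rw [abs_abs]; exact abs_ou_le hfB _ _) (integrable_of_abs_le (B := B)
      (measurable_ou (f := fun x => |f x|) hf.abs ρ) fun x => ?_) fun x => ?_
  · exact abs_ou_le (f := fun x => |f x|) (fun x => by rw [abs_abs]; exact hfB x) _ _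
  · exact abs_integral_le_integral_abs

/-- The semigroup property of the Ornstein–Uhlenbeck operators. -/
lemma ou_ou (hf : Measurable f) (hfB : ∀ x, |f x| ≤ B) {a b : ℝ} (ha0 : 0 ≤ a) (ha1 : a ≤ 1)
    (hb0 : 0 ≤ b) (hb1 : b ≤ 1) : ou a (ou b f) = ou (a * b) f := by
  ext x
  have hab : (a * b) ^ 2 ≤ 1 := by
    have := mul_nonneg ha0 hb0
    have := mul_le_one₀ ha1 hb0 hb1
    nlinarith
  have hα : (b * √(1 - a ^ 2)) ^ 2 + √(1 - b ^ 2) ^ 2 = √(1 - (a * b) ^ 2) ^ 2 := by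
    rw [mul_pow, Real.sq_sqrt (by nlinarith), Real.sq_sqrt (by nlinarith),
      Real.sq_sqrt (by linarith)]
    ring
  set α := b * √(1 - a ^ 2)
  set β := √(1 - b ^ 2)
  set τ := √(1 - (a * b) ^ 2)
  have h1 : ou a (ou b f) x =
      ∫ p, f ((a * b) • x + (α • p.1 + β • p.2)) ∂(gauss n).prod (gauss n) := by
    rw [integral_prod _ (integrable_of_abs_le (by fun_prop) fun p => hfB _)]
    refine integral_congr_ae (ae_of_all _ fun z => ?_)
    refine integral_congr_ae (ae_of_all _ fun w => ?_)
    simp only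
    congr 1
    simp only [α, β]
    module
  rw [h1]
  by_cases hτ : τ = 0
  · rw [hτ] at hα
    have hα0 : α = 0 := by nlinarith [sq_nonneg α, sq_nonneg β]
    have hβ0 : β = 0 := by nlinarith [sq_nonneg α, sq_nonneg β]
    simp [ou, hα0, hβ0, show √(1 - (a * b) ^ 2) = 0 from hτ]
  · have h2 : (α / τ) ^ 2 + (β / τ) ^ 2 = 1 := by
      field_simp; exact hα
    rw [ou, ← integral_comp_measurePreserving
      (measurePreserving_add_smul (integral_id_gauss n) h2)
      (f := fun z => f ((a * b) • x + τ • z)) (by fun_prop)]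
    refine integral_congr_ae (ae_of_all _ fun p => ?_)
    simp only [smul_add, smul_smul, mul_div_cancel₀ _ hτ]

lemma integral_mul_ou_sq (hf : Measurable f) (hfB : ∀ x, |f x| ≤ B) (hρ0 : 0 ≤ ρ) (hρ1 : ρ ≤ 1) :
    ∫ x, f x * ou (ρ ^ 2) f x ∂gauss n = ∫ x, ou ρ f x ^ 2 ∂gauss n := by
  rw [sq ρ, ← ou_ou hf hfB hρ0 hρ1 hρ0 hρ1,
    integral_mul_ou_comm (measurable_ou hf ρ) (abs_ou_le hfB ρ) hf hfB hρ0 hρ1]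
  simp only [sq]

lemma integral_sq_le (hf : Measurable f) (hfB : ∀ x, |f x| ≤ B) {a : ℝ}
    (ha : ∫ x, |f x| ∂gauss n ≤ a) (hB : 0 ≤ B) : ∫ x, f x ^ 2 ∂gauss n ≤ a * B := by
  calc ∫ x, f x ^ 2 ∂gauss n ≤ ∫ x, |f x| * B ∂gauss n := by
        refine integral_mono (integrable_of_abs_le (B := B ^ 2) (by fun_prop) fun x => ?_)
          ((integrable_of_abs_le (B := B) hf.abs fun x => by rw [abs_abs]; exact hfB x).mul_const B)
          fun x => ?_
        · rw [abs_pow]; exact pow_le_pow_left₀ (abs_nonneg _) (hfB x) 2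
        · simp only [← sq_abs (f x), sq]
          exact mul_le_mul_of_nonneg_left (hfB x) (abs_nonneg _)
    _ = (∫ x, |f x| ∂gauss n) * B := integral_mul_const _ _
    _ ≤ a * B := by gcongr

lemma sq_integral_mul_ou_le (hf : Measurable f) (hfB : ∀ x, |f x| ≤ B) (hρ0 : 0 ≤ ρ)
    (hρ1 : ρ ≤ 1) : (∫ x, f x * ou ρ f x ∂gauss n) ^ 2 ≤
      (∫ x, f x ^ 2 ∂gauss n) * ∫ x, f x * ou (ρ ^ 2) f x ∂gauss n := by
  rw [integral_mul_ou_sq hf hfB hρ0 hρ1]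
  have hm := measurable_ou hf ρ
  have h2 : ∀ {u : (Fin n → ℝ) → ℝ} (x), |u x| ≤ B → |u x ^ 2| ≤ B ^ 2 := fun x hx => by
    rw [abs_pow]; exact pow_le_pow_left₀ (abs_nonneg _) hx 2
  exact sq_integral_mul_le (integrable_of_abs_le (by fun_prop) fun x => h2 x (hfB x))
    (integrable_of_abs_le (by fun_prop) fun x => h2 x (abs_ou_le hfB ρ x))
    (integrable_of_abs_le (by fun_prop) fun x => abs_mul_le_mul (hfB x) (abs_ou_le hfB ρ x))

lemma integral_mul_ou_le (hf : Measurable f) (hfB : ∀ x, |f x| ≤ B) {a : ℝ} (ha0 : 0 < a)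
    (ha : ∫ x, |f x| ∂gauss n ≤ a) (hB : 1 ≤ B) (hρ0 : 0 ≤ ρ) (hρ1 : ρ ≤ 1) :
    ∫ x, f x * ou ρ f x ∂gauss n ≤ a * B := by
  have h1 := sq_integral_mul_ou_le hf hfB hρ0 hρ1
  have h2 := integral_sq_le hf hfB ha (by linarith)
  have h3 := integral_sq_le (measurable_ou hf ρ) (abs_ou_le hfB ρ)
    ((integral_abs_ou_le hf hfB hρ0 hρ1).trans ha) (by linarith)
  rw [integral_mul_ou_sq hf hfB hρ0 hρ1] at h1
  refine (le_abs_self _).trans (abs_le_of_sq_le_sq (h1.trans ?_) (by positivity))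
  rw [sq]
  exact mul_le_mul h2 h3 (integral_nonneg fun x => sq_nonneg _) (by positivity)

/-- The bound given by hypercontractivity for small `ρ`. -/
lemma integral_mul_ou_le_of_le (hf : Measurable f) (hfB : ∀ x, |f x| ≤ B) {a : ℝ} (ha0 : 0 < a)
    (ha : ∫ x, |f x| ∂gauss n ≤ a) (hB : 1 ≤ B) (hρ0 : 0 ≤ ρ) (hρ1 : ρ ≤ 5 / 13) :
    ∫ x, f x * ou ρ f x ∂gauss n ≤ a * B * a ^ (1 / 4 : ℝ) := by
  have hB0 : 0 < B := by linarith
  obtain ⟨τ, hτ0, hτ1, rfl⟩ : ∃ τ, 0 ≤ τ ∧ τ ≤ 1 ∧ ρ = 5 / 13 * τ :=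
    ⟨13 / 5 * ρ, by linarith, by linarith, by ring⟩
  rw [← ou_ou hf hfB (by norm_num) (by norm_num) hτ0 hτ1]
  have hk := measurable_ou hf τ
  have hkB := abs_ou_le hfB τ
  have hka := (integral_abs_ou_le hf hfB hτ0 hτ1).trans ha
  set k := ou τ f
  have hsq : √(1 - (5 / 13 : ℝ) ^ 2) = 12 / 13 := by
    rw [show 1 - (5 / 13 : ℝ) ^ 2 = (12 / 13) ^ 2 by norm_num]
    exact Real.sqrt_sq (by norm_num)
  rw [integral_mul_ou hk hkB hf hfB, hsq]
  have key : ENNReal.ofReal (∫ p, f p.1 * k ((5 / 13 : ℝ) • p.1 + (12 / 13 : ℝ) • p.2)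
      ∂(gauss n).prod (gauss n)) ≤ ENNReal.ofReal (a ^ (5 / 4 : ℝ) * B ^ (3 / 4 : ℝ)) := by
    set H : (Fin n → ℝ) → ℝ≥0∞ := fun x => ENNReal.ofReal |f x|
    set K : (Fin n → ℝ) → ℝ≥0∞ := fun x => ENNReal.ofReal |k x|
    have hH : Measurable H := by fun_prop
    have hK : Measurable K := by fun_prop
    have hHB : ∀ x, H x ≤ ENNReal.ofReal B := fun x => ENNReal.ofReal_le_ofReal (hfB x)
    have hKB : ∀ x, K x ≤ ENNReal.ofReal B := fun x => ENNReal.ofReal_le_ofReal (hkB x)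
    have hHa : ∫⁻ x, H x ∂gauss n ≤ ENNReal.ofReal a := by
      rw [← ofReal_integral_eq_lintegral_ofReal (integrable_of_abs_le (B := B) hf.abs fun x => by
        rw [abs_abs]; exact hfB x) (ae_of_all _ fun x => abs_nonneg _)]
      exact ENNReal.ofReal_le_ofReal ha
    have hKa : ∫⁻ x, K x ∂gauss n ≤ ENNReal.ofReal a := by
      rw [← ofReal_integral_eq_lintegral_ofReal (integrable_of_abs_le (B := B) hk.abs fun x => by
        rw [abs_abs]; exact hkB x) (ae_of_all _ fun x => abs_nonneg _)]
      exact ENNReal.ofReal_le_ofReal hka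
    have hU : ∫⁻ x, H x ^ (4 / 3 : ℝ) ∂gauss n ≤ ENNReal.ofReal (a * B ^ (1 / 3 : ℝ)) := by
      calc ∫⁻ x, H x ^ (4 / 3 : ℝ) ∂gauss n
          ≤ ∫⁻ x, H x * ENNReal.ofReal B ^ (1 / 3 : ℝ) ∂gauss n := by
            refine lintegral_mono fun x => ?_
            rw [show (4 / 3 : ℝ) = 1 + 1 / 3 by norm_num,
              ENNReal.rpow_add_of_nonneg _ _ (by norm_num) (by norm_num), ENNReal.rpow_one]
            have := hHB x
            gcongr
        _ = (∫⁻ x, H x ∂gauss n) * ENNReal.ofReal B ^ (1 / 3 : ℝ) := lintegral_mul_const _ hH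
        _ ≤ ENNReal.ofReal a * ENNReal.ofReal B ^ (1 / 3 : ℝ) := by gcongr
        _ = _ := by rw [ENNReal.ofReal_rpow_of_pos hB0, ENNReal.ofReal_mul ha0.le]
    have hV : ∫⁻ x, K x ^ (2 : ℝ) ∂gauss n ≤ ENNReal.ofReal (a * B) := by
      calc ∫⁻ x, K x ^ (2 : ℝ) ∂gauss n
          ≤ ∫⁻ x, K x * ENNReal.ofReal B ∂gauss n := by
            refine lintegral_mono fun x => ?_
            rw [ENNReal.rpow_two, sq]
            have := hKB x
            gcongr
        _ = (∫⁻ x, K x ∂gauss n) * ENNReal.ofReal B := lintegral_mul_const _ hK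
        _ ≤ ENNReal.ofReal a * ENNReal.ofReal B := by gcongr
        _ = _ := by rw [ENNReal.ofReal_mul ha0.le]
    have hyp := lintegral_rpow_mul_rpow_gauss_le (hH.pow_const (4 / 3 : ℝ))
      (hK.pow_const (2 : ℝ)) (B := (B.toNNReal) ^ (2 : ℝ)) fun x => by
        rw [ENNReal.coe_rpow_of_nonneg _ (by norm_num)]
        exact ENNReal.rpow_le_rpow (hKB x) (by norm_num)
    simp_rw [← ENNReal.rpow_mul] at hyp
    norm_num at hyp
    have hm : Measurable fun p : (Fin n → ℝ) × (Fin n → ℝ) =>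
        f p.1 * k ((5 / 13 : ℝ) • p.1 + (12 / 13 : ℝ) • p.2) := by fun_prop
    have hint : Integrable (fun p : (Fin n → ℝ) × (Fin n → ℝ) =>
        f p.1 * k ((5 / 13 : ℝ) • p.1 + (12 / 13 : ℝ) • p.2)) ((gauss n).prod (gauss n)) :=
      integrable_of_abs_le hm fun p => abs_mul_le_mul (hfB _) (hkB _)
    calc _ ≤ ENNReal.ofReal (∫ p, |f p.1 * k ((5 / 13 : ℝ) • p.1 + (12 / 13 : ℝ) • p.2)|
          ∂(gauss n).prod (gauss n)) :=
          ENNReal.ofReal_le_ofReal (integral_mono hint hint.abs fun p => le_abs_self _)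
      _ = ∫⁻ x, ∫⁻ z, H x * K ((5 / 13 : ℝ) • x + (12 / 13 : ℝ) • z) ∂gauss n ∂gauss n := by
          rw [ofReal_integral_eq_lintegral_ofReal hint.abs (ae_of_all _ fun p => abs_nonneg _),
            lintegral_prod _ (by fun_prop)]
          simp only [abs_mul, ENNReal.ofReal_mul (abs_nonneg _), H, K]
      _ ≤ (ENNReal.ofReal (a * B ^ (1 / 3 : ℝ))) ^ (3 / 4 : ℝ) *
          (ENNReal.ofReal (a * B)) ^ (1 / 2 : ℝ) := by
          refine hyp.trans ?_
          refine mul_le_mul' (ENNReal.rpow_le_rpow hU (by norm_num))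
            (ENNReal.rpow_le_rpow (by simpa using hV) (by norm_num))
      _ = _ := by
          rw [ENNReal.ofReal_rpow_of_pos (by positivity),
            ENNReal.ofReal_rpow_of_pos (by positivity),
            ← ENNReal.ofReal_mul (by positivity), Real.mul_rpow ha0.le (by positivity),
            Real.mul_rpow ha0.le (by positivity), ← Real.rpow_mul hB0.le]
          congr 1
          rw [show (5 / 4 : ℝ) = 3 / 4 + 1 / 2 by norm_num, Real.rpow_add ha0,
            show (3 / 4 : ℝ) = 1 / 4 + 1 / 2 by norm_num, Real.rpow_add hB0]
          norm_num
          ring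
  rw [ENNReal.ofReal_le_ofReal_iff (by positivity)] at key
  refine key.trans ?_
  have h1 : B ^ (3 / 4 : ℝ) ≤ B := by
    conv_rhs => rw [← Real.rpow_one B]
    exact Real.rpow_le_rpow_of_exponent_le hB (by norm_num)
  calc a ^ (5 / 4 : ℝ) * B ^ (3 / 4 : ℝ) ≤ a ^ (5 / 4 : ℝ) * B := by gcongr
    _ = _ := by
      rw [show (5 / 4 : ℝ) = 1 + 1 / 4 by norm_num, Real.rpow_add ha0, Real.rpow_one]; ring

lemma integral_mul_ou_le_of_pow_le (hf : Measurable f) (hfB : ∀ x, |f x| ≤ B) {a : ℝ}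
    (ha0 : 0 < a) (ha : ∫ x, |f x| ∂gauss n ≤ a) (hB : 1 ≤ B) (k : ℕ) :
    ∀ {ρ : ℝ}, 0 ≤ ρ → ρ ≤ 1 → ρ ^ 2 ^ k ≤ 5 / 13 →
      ∫ x, f x * ou ρ f x ∂gauss n ≤ a * B * a ^ (1 / 4 * (1 / 2) ^ k : ℝ) := by
  induction k with
  | zero =>
    intro ρ hρ0 _ h
    simpa using integral_mul_ou_le_of_le hf hfB ha0 ha hB hρ0 (by simpa using h)
  | succ k ih =>
    intro ρ hρ0 hρ1 h
    have h1 := ih (ρ := ρ ^ 2) (by positivity) (pow_le_one₀ hρ0 hρ1) (by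
      rwa [← pow_mul, ← pow_succ'])
    have h2 := integral_sq_le hf hfB ha (by linarith)
    refine (le_abs_self _).trans (abs_le_of_sq_le_sq
      ((sq_integral_mul_ou_le hf hfB hρ0 hρ1).trans ?_) (by positivity))
    calc _ ≤ (a * B) * (a * B * a ^ (1 / 4 * (1 / 2) ^ k : ℝ)) := by
          refine mul_le_mul h2 h1 ?_ (by positivity)
          rw [integral_mul_ou_sq hf hfB hρ0 hρ1]
          exact integral_nonneg fun x => sq_nonneg _
      _ = _ := by
          rw [mul_pow, ← Real.rpow_mul_natCast ha0.le,
            show (1 / 4 * (1 / 2) ^ (k + 1) * (2 : ℕ) : ℝ) = 1 / 4 * (1 / 2) ^ k by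
              push_cast; ring]
          ring

/-- A bound on the quadratic form of the Ornstein–Uhlenbeck operator in terms of the `L¹`-norm. -/
lemma integral_mul_ou_le_exp (hf : Measurable f) (hfB : ∀ x, |f x| ≤ B) {a : ℝ}
    (ha0 : 0 < a) (ha : ∫ x, |f x| ∂gauss n ≤ a) (hB : 1 ≤ B) (hρ0 : 0 ≤ ρ) (hρ1 : ρ < 1) :
    ∫ x, f x * ou ρ f x ∂gauss n ≤
      a * B * Real.exp (-((1 - ρ) / 8 * max (Real.log (1 / a)) 0)) := by
  have hlog : Real.log (1 / a) = -Real.log a := by rw [one_div, Real.log_inv]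
  rcases le_total 1 a with h1 | h1
  · rw [max_eq_right (by rw [hlog]; linarith [Real.log_nonneg h1])]
    simpa using integral_mul_ou_le hf hfB ha0 ha hB hρ0 hρ1.le
  · rw [max_eq_left (by rw [hlog]; linarith [Real.log_nonpos ha0.le h1])]
    have h1ρ : 0 < 1 - ρ := by linarith
    obtain ⟨k, hk1, hk2⟩ := exists_nat_pow_near (x := 1 / (1 - ρ)) (y := 2)
      (by rw [le_div_iff₀ h1ρ]; linarith) (by norm_num)
    rw [le_div_iff₀ h1ρ] at hk1
    rw [div_lt_iff₀ h1ρ] at hk2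
    have hpow : ρ ^ 2 ^ (k + 1) ≤ 5 / 13 := by
      calc ρ ^ 2 ^ (k + 1) ≤ Real.exp (-(1 - ρ)) ^ 2 ^ (k + 1) := by
            gcongr
            linarith [Real.add_one_le_exp (-(1 - ρ))]
        _ = Real.exp (-(2 ^ (k + 1) * (1 - ρ))) := by
            rw [← Real.exp_nat_mul]; push_cast; ring_nf
        _ ≤ Real.exp (-1) := Real.exp_le_exp.2 (by linarith)
        _ ≤ 5 / 13 := by
            rw [Real.exp_neg, inv_le_comm₀ (Real.exp_pos _) (by norm_num)]
            linarith [Real.exp_one_gt_d9]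
    refine (integral_mul_ou_le_of_pow_le hf hfB ha0 ha hB (k + 1) hρ0 hρ1.le hpow).trans ?_
    gcongr
    rw [Real.rpow_def_of_pos ha0, Real.exp_le_exp, hlog]
    have h2 : (1 - ρ) / 2 ≤ (1 / 2) ^ (k + 1) := by
      rw [one_div, inv_pow, pow_succ, mul_inv, ← div_eq_mul_inv]
      gcongr
      rwa [← one_div, le_div_iff₀ (by positivity), mul_comm]
    nlinarith [Real.log_nonpos ha0.le h1]

end OrnsteinUhlenbeck

lemma integrable_id_gaussianReal : Integrable (fun t : ℝ => t) (gaussianReal 0 1) :=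
  (memLp_id_gaussianReal' 1 (by simp)).integrable le_rfl

lemma integral_sq_gaussianReal : ∫ t, t ^ 2 ∂gaussianReal 0 1 = 1 := by
  have := variance_id_gaussianReal (μ := 0) (v := 1)
  rw [variance_eq_integral (by fun_prop)] at this
  simpa using this

lemma integral_abs_gaussianReal_le : ∫ t, |t| ∂gaussianReal 0 1 ≤ 1 := by
  have h2 : Integrable (fun t : ℝ => t ^ 2) (gaussianReal 0 1) :=
    (memLp_id_gaussianReal' 2 (by simp)).integrable_sq
  have := sq_integral_mul_le (μ := gaussianReal 0 1) (f := fun t => |t|) (g := fun _ => 1)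
    (by simpa using h2) (by simp) (by simpa using integrable_id_gaussianReal.abs)
  simp only [sq_abs, mul_one, integral_sq_gaussianReal] at this
  refine (le_abs_self _).trans (abs_le_of_sq_le_sq (by simpa using this) zero_le_one)

/-- Gaussian integration by parts on the line. -/
lemma integral_deriv_gaussianReal {u u' : ℝ → ℝ} (hu : ∀ t, HasDerivAt u (u' t) t)
    (hu' : Measurable u') {B : ℝ} (hB : ∀ t, |u t| ≤ B) (hB' : ∀ t, |u' t| ≤ B) :
    ∫ t, u' t ∂gaussianReal 0 1 = ∫ t, u t * t ∂gaussianReal 0 1 := by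
  have hum : Measurable u :=
    (continuous_iff_continuousAt.2 fun t => (hu t).continuousAt).measurable
  have hp : ∀ t, HasDerivAt (gaussianPDFReal 0 1) (-(gaussianPDFReal 0 1 t * t)) t := fun t => by
    have h1 : HasDerivAt (fun x : ℝ => (√(2 * Real.pi))⁻¹ * Real.exp (-x ^ 2 / 2))
        ((√(2 * Real.pi))⁻¹ * (Real.exp (-t ^ 2 / 2) * (-(2 * t) / 2))) t := by
      have h2 : HasDerivAt (fun x : ℝ => -x ^ 2 / 2) (-(2 * t) / 2) t := by
        simpa using ((hasDerivAt_pow 2 t).neg.div_const 2)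
      exact h2.exp.const_mul _
    rw [show gaussianPDFReal 0 1 = _ from funext gaussianPDFReal_standard]
    convert h1 using 1
    ring
  have i1 : Integrable u (gaussianReal 0 1) := integrable_of_abs_le hum hB
  have i2 : Integrable u' (gaussianReal 0 1) := integrable_of_abs_le hu' hB'
  have i3 : Integrable (fun t => u t * t) (gaussianReal 0 1) :=
    integrable_id_gaussianReal.bdd_mul (c := B) hum.aestronglyMeasurable (ae_of_all _ hB)
  rw [integrable_gaussianReal_iff one_ne_zero] at i1 i2 i3
  rw [integral_gaussianReal_eq_integral_smul one_ne_zero,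
    integral_gaussianReal_eq_integral_smul one_ne_zero]
  have := integral_mul_deriv_eq_deriv_mul_of_integrable (u := u) (v := gaussianPDFReal 0 1)
    (fun t _ => hu t) (fun t _ => hp t)
    (i3.neg.congr (ae_of_all _ fun t => by simp only [Pi.neg_apply, Pi.mul_apply]; ring))
    (i2.congr (ae_of_all _ fun t => by simp only [Pi.mul_apply]; ring))
    (i1.congr (ae_of_all _ fun t => by simp only [Pi.mul_apply]; ring))
  rw [← neg_inj, integral_congr_ae (g := fun t => u' t * gaussianPDFReal 0 1 t)
    (ae_of_all _ fun t => by simp only [smul_eq_mul]; ring), ← this, ← integral_neg]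
  refine integral_congr_ae (ae_of_all _ fun t => ?_)
  simp only [smul_eq_mul]
  ring

section Coordinates

variable {n : ℕ} {f : (Fin n → ℝ) → ℝ}

lemma measurePreserving_eval_gauss (i : Fin n) :
    MeasurePreserving (fun x : Fin n → ℝ => x i) (gauss n) (gaussianReal 0 1) :=
  measurePreserving_eval (fun _ : Fin n => gaussianReal 0 1) i

lemma integrable_eval_gauss (i : Fin n) : Integrable (fun x : Fin n → ℝ => x i) (gauss n) :=
  (measurePreserving_eval_gauss i).integrable_comp_of_integrable integrable_id_gaussianReal

lemma integral_abs_eval_gauss_le (i : Fin n) : ∫ x, |x i| ∂gauss n ≤ 1 := by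
  rw [integral_comp_measurePreserving (measurePreserving_eval_gauss i) (f := fun t => |t|)
    (by fun_prop)]
  exact integral_abs_gaussianReal_le

lemma measurable_pd (hf : ContDiff ℝ 1 f) (i : Fin n) : Measurable (pd i f) :=
  ((hf.continuous_fderiv one_ne_zero).clm_apply continuous_const).measurable

lemma integral_gauss_succAbove {i : Fin (n + 1)} {F : (Fin (n + 1) → ℝ) → ℝ}
    (hF : Integrable F (gauss (n + 1))) :
    ∫ x, F x ∂gauss (n + 1) =
      ∫ y, ∫ t, F (i.insertNth t y) ∂gaussianReal 0 1 ∂gauss n := by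
  have h := (measurePreserving_piFinSuccAbove (fun _ : Fin (n + 1) => gaussianReal 0 1) i).symm
  have hF' : Integrable (fun p : ℝ × (Fin n → ℝ) => F (i.insertNth p.1 p.2))
      ((gaussianReal 0 1).prod (gauss n)) := h.integrable_comp_of_integrable hF
  have h' := h.integral_comp (MeasurableEquiv.measurableEmbedding _) F
  rw [gauss, ← h', ← integral_prod_symm _ hF']
  rfl

/-- Gaussian integration by parts. -/
lemma integral_pd_eq (hf : ContDiff ℝ 1 f) {B : ℝ} (hB : ∀ x, |f x| ≤ B) {i : Fin n}
    (hB' : ∀ x, |pd i f x| ≤ B) : ∫ x, pd i f x ∂gauss n = ∫ x, f x * x i ∂gauss n := by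
  obtain _ | n := n
  · exact i.elim0
  have hm := measurable_pd hf i
  have hfm : Measurable f := hf.continuous.measurable
  rw [integral_gauss_succAbove (i := i) (integrable_of_abs_le hm hB'),
    integral_gauss_succAbove (i := i) ((integrable_eval_gauss i).bdd_mul (c := B)
      hfm.aestronglyMeasurable (ae_of_all _ hB))]
  refine integral_congr_ae (ae_of_all _ fun y => ?_)
  have hins : ∀ t : ℝ, HasDerivAt (fun t : ℝ => (i.insertNth t y : Fin (n + 1) → ℝ))
      (Pi.single i 1) t := fun t => by
    refine hasDerivAt_pi.2 fun j => ?_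
    rcases Fin.eq_self_or_eq_succAbove i j with rfl | ⟨k, rfl⟩
    · simpa using hasDerivAt_id' t
    · simpa using hasDerivAt_const t (y k)
  have hc : Continuous fun t : ℝ => (i.insertNth t y : Fin (n + 1) → ℝ) :=
    continuous_iff_continuousAt.2 fun t => (hins t).continuousAt
  have := integral_deriv_gaussianReal (u := fun t => f (i.insertNth t y))
    (u' := fun t => pd i f (i.insertNth t y))
    (fun t => ((hf.differentiable one_ne_zero _).hasFDerivAt.comp_hasDerivAt t (hins t)))
    (hm.comp hc.measurable) (fun t => hB _) (fun t => hB' _)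
  simpa using this

lemma pd_comp_affine (hf : ContDiff ℝ 1 f) (i : Fin n) (x : Fin n → ℝ) (s : ℝ) (z : Fin n → ℝ) :
    pd i (fun z => f (x + s • z)) z = s * pd i f (x + s • z) := by
  have h1 : HasFDerivAt (fun z : Fin n → ℝ => x + s • z)
      (s • ContinuousLinearMap.id ℝ (Fin n → ℝ)) z :=
    ((hasFDerivAt_id z).const_smul s).const_add x
  have h2 := (hf.differentiable one_ne_zero (x + s • z)).hasFDerivAt.comp z h1
  rw [pd, show (fun z => f (x + s • z)) = f ∘ fun z => x + s • z from rfl, h2.fderiv]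
  simp [pd]

lemma mul_integral_pd_affine (hf : ContDiff ℝ 1 f) {B : ℝ} (hB : ∀ x, |f x| ≤ B) {i : Fin n}
    (hB' : ∀ x, |pd i f x| ≤ B) (x : Fin n → ℝ) (s : ℝ) :
    s * ∫ z, pd i f (x + s • z) ∂gauss n = ∫ z, f (x + s • z) * z i ∂gauss n := by
  rw [← integral_const_mul]
  simp_rw [← pd_comp_affine hf]
  have hB0 : 0 ≤ B := (abs_nonneg _).trans (hB 0)
  refine integral_pd_eq (B := max B (|s| * B)) (hf.comp (by fun_prop))
    (fun z => (hB _).trans (le_max_left _ _)) fun z => ?_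
  change |pd i (fun z => f (x + s • z)) z| ≤ _
  rw [pd_comp_affine hf, abs_mul]
  exact (mul_le_mul_of_nonneg_left (hB' _) (abs_nonneg s)).trans (le_max_right _ _)

/-- The gradient bound for the Ornstein–Uhlenbeck operator. -/
lemma abs_ou_pd_le (hf : ContDiff ℝ 1 f) (hf1 : ∀ x, |f x| ≤ 1) {i : Fin n} {B : ℝ}
    (hB : ∀ x, |pd i f x| ≤ B) {ρ : ℝ} (hρ0 : 0 ≤ ρ) (hρ1 : ρ < 1) (x : Fin n → ℝ) :
    |ou ρ (pd i f) x| ≤ 1 / √(1 - ρ ^ 2) := by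
  have hs : 0 < √(1 - ρ ^ 2) := Real.sqrt_pos.2 (by nlinarith)
  have h := mul_integral_pd_affine hf (B := max 1 B) (fun x => (hf1 x).trans (le_max_left _ _))
    (i := i) (fun x => (hB x).trans (le_max_right _ _)) (ρ • x) (√(1 - ρ ^ 2))
  rw [le_div_iff₀' hs]
  calc √(1 - ρ ^ 2) * |ou ρ (pd i f) x|
      = |∫ z, f (ρ • x + √(1 - ρ ^ 2) • z) * z i ∂gauss n| := by
        rw [← h, abs_mul, abs_of_pos hs, ou]
    _ ≤ ∫ z, |z i| ∂gauss n := by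
        rw [← Real.norm_eq_abs]
        refine norm_integral_le_of_norm_le (integrable_eval_gauss i).abs (ae_of_all _ fun z => ?_)
        rw [Real.norm_eq_abs, abs_mul]
        exact mul_le_of_le_one_left (abs_nonneg _) (hf1 _)
    _ ≤ 1 := integral_abs_eval_gauss_le i

end Coordinates

section Interpolation

variable {n : ℕ} {f : (Fin n → ℝ) → ℝ}

lemma fderiv_eq_sum_pd (x v : Fin n → ℝ) : fderiv ℝ f x v = ∑ i, pd i f x * v i := by
  conv_lhs => rw [pi_eq_sum_univ' v]
  simp only [map_sum, map_smul, smul_eq_mul, pd]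
  exact Finset.sum_congr rfl fun i _ => mul_comm _ _

/-- The derivative of the covariance of `f` along a rotation. -/
lemma hasDerivAt_integral_rotation (hf : ContDiff ℝ 1 f) (hf1 : ∀ x, |f x| ≤ 1) {B : ℝ}
    (hB : ∀ i x, |pd i f x| ≤ B) (θ : ℝ) :
    HasDerivAt (fun θ => ∫ p, f p.1 * f (Real.cos θ • p.1 + Real.sin θ • p.2)
        ∂(gauss n).prod (gauss n))
      (∑ i, ∫ p, f p.1 * (pd i f (Real.cos θ • p.1 + Real.sin θ • p.2) *
        (-Real.sin θ * p.1 i + Real.cos θ * p.2 i)) ∂(gauss n).prod (gauss n)) θ := by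
  have hfm : Measurable f := hf.continuous.measurable
  have hpm : ∀ i, Measurable (pd i f) := measurable_pd hf
  have hx : ∀ i, Integrable (fun p : (Fin n → ℝ) × (Fin n → ℝ) => |p.1 i|)
      ((gauss n).prod (gauss n)) := fun i =>
    measurePreserving_fst.integrable_comp_of_integrable (integrable_eval_gauss i).abs
  have hz : ∀ i, Integrable (fun p : (Fin n → ℝ) × (Fin n → ℝ) => |p.2 i|)
      ((gauss n).prod (gauss n)) := fun i =>
    measurePreserving_snd.integrable_comp_of_integrable (integrable_eval_gauss i).abs
  have hbi : ∀ i, Integrable (fun p : (Fin n → ℝ) × (Fin n → ℝ) => B * (|p.1 i| + |p.2 i|))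
      ((gauss n).prod (gauss n)) := fun i => ((hx i).add (hz i)).const_mul B
  have hbound : ∀ i (t : ℝ) (p : (Fin n → ℝ) × (Fin n → ℝ)),
      |f p.1 * (pd i f (Real.cos t • p.1 + Real.sin t • p.2) *
        (-Real.sin t * p.1 i + Real.cos t * p.2 i))| ≤ B * (|p.1 i| + |p.2 i|) := fun i t p => by
    have h1 : |-Real.sin t * p.1 i + Real.cos t * p.2 i| ≤ |p.1 i| + |p.2 i| := by
      refine (abs_add_le _ _).trans (add_le_add ?_ ?_) <;> rw [abs_mul]
      · rw [abs_neg]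
        exact mul_le_of_le_one_left (abs_nonneg _) (Real.abs_sin_le_one t)
      · exact mul_le_of_le_one_left (abs_nonneg _) (Real.abs_cos_le_one t)
    simpa using abs_mul_le_mul (hf1 p.1) (abs_mul_le_mul (hB i _) h1)
  have hint : ∀ i, Integrable (fun p : (Fin n → ℝ) × (Fin n → ℝ) =>
      f p.1 * (pd i f (Real.cos θ • p.1 + Real.sin θ • p.2) *
        (-Real.sin θ * p.1 i + Real.cos θ * p.2 i))) ((gauss n).prod (gauss n)) := fun i =>
    (hbi i).mono' (Measurable.aestronglyMeasurable (by fun_prop))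
      (ae_of_all _ fun p => hbound i θ p)
  rw [← integral_finsetSum _ fun i _ => hint i]
  refine (hasDerivAt_integral_of_dominated_loc_of_deriv_le (s := Set.univ)
    (bound := fun p => ∑ i, B * (|p.1 i| + |p.2 i|))
    (F := fun θ (p : (Fin n → ℝ) × (Fin n → ℝ)) =>
      f p.1 * f (Real.cos θ • p.1 + Real.sin θ • p.2))
    (F' := fun θ (p : (Fin n → ℝ) × (Fin n → ℝ)) => ∑ i, f p.1 *
      (pd i f (Real.cos θ • p.1 + Real.sin θ • p.2) *
        (-Real.sin θ * p.1 i + Real.cos θ * p.2 i)))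
    Filter.univ_mem (Filter.Eventually.of_forall fun t =>
      Measurable.aestronglyMeasurable (by fun_prop))
    (integrable_of_abs_le (B := 1 * 1) (by fun_prop) fun p => abs_mul_le_mul (hf1 _) (hf1 _))
    (Measurable.aestronglyMeasurable (by fun_prop))
    (ae_of_all _ fun p t _ => (norm_sum_le _ _).trans
      (Finset.sum_le_sum fun i _ => hbound i t p))
    (integrable_finsetSum _ fun i _ => hbi i)
    (ae_of_all _ fun p t _ => ?_)).2
  have h1 : HasDerivAt (fun t : ℝ => Real.cos t • p.1 + Real.sin t • p.2)
      (-Real.sin t • p.1 + Real.cos t • p.2) t :=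
    ((Real.hasDerivAt_cos t).smul_const p.1).add ((Real.hasDerivAt_sin t).smul_const p.2)
  have h2 := ((hf.differentiable one_ne_zero
    (Real.cos t • p.1 + Real.sin t • p.2)).hasFDerivAt.comp_hasDerivAt t h1).const_mul (f p.1)
  rw [fderiv_eq_sum_pd, Finset.mul_sum] at h2
  exact h2

lemma integral_rotation_mul_pd (hf : ContDiff ℝ 1 f) (hf1 : ∀ x, |f x| ≤ 1) {B : ℝ} {i : Fin n}
    (hB : ∀ x, |pd i f x| ≤ B) {c s : ℝ} (hcs : c ^ 2 + s ^ 2 = 1) (hs : 0 ≤ s) :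
    ∫ p, f p.1 * (pd i f (c • p.1 + s • p.2) * (-s * p.1 i + c * p.2 i))
        ∂(gauss n).prod (gauss n) =
      -(s * ∫ x, pd i f x * ou c (pd i f) x ∂gauss n) := by
  have hfm : Measurable f := hf.continuous.measurable
  have hpm : Measurable (pd i f) := measurable_pd hf i
  have hs' : √(1 - c ^ 2) = s := by
    rw [show 1 - c ^ 2 = s ^ 2 by linarith, Real.sqrt_sq hs]
  rw [← integral_comp_measurePreserving
    (measurePreserving_reflection (integral_id_gauss n) hcs) (by fun_prop)]
  have h1 : ∀ p : (Fin n → ℝ) × (Fin n → ℝ),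
      c • (c • p.1 + s • p.2) + s • (s • p.1 - c • p.2) = p.1 := fun p => by
    conv_rhs => rw [← one_smul ℝ p.1, ← hcs]
    module
  have h2 : ∀ p : (Fin n → ℝ) × (Fin n → ℝ),
      -s * (c • p.1 + s • p.2) i + c * (s • p.1 - c • p.2) i = -p.2 i := fun p => by
    simp only [Pi.add_apply, Pi.sub_apply, Pi.smul_apply, smul_eq_mul]
    linear_combination -(p.2 i) * hcs
  simp only [h1, h2]
  have hint : Integrable (fun p : (Fin n → ℝ) × (Fin n → ℝ) =>
      f (c • p.1 + s • p.2) * (pd i f p.1 * -p.2 i)) ((gauss n).prod (gauss n)) := by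
    have hz : Integrable (fun p : (Fin n → ℝ) × (Fin n → ℝ) => -p.2 i)
        ((gauss n).prod (gauss n)) :=
      (measurePreserving_snd.integrable_comp_of_integrable (integrable_eval_gauss i)).neg
    exact (hz.bdd_mul (c := B) (Measurable.aestronglyMeasurable (by fun_prop))
      (ae_of_all _ fun p => hB p.1)).bdd_mul (c := 1)
      (Measurable.aestronglyMeasurable (by fun_prop)) (ae_of_all _ fun p => hf1 _)
  rw [integral_prod _ hint, ← integral_const_mul, ← integral_neg]
  refine integral_congr_ae (ae_of_all _ fun x => ?_)
  have h3 := mul_integral_pd_affine hf (B := max 1 B) (fun x => (hf1 x).trans (le_max_left _ _))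
    (i := i) (fun x => (hB x).trans (le_max_right _ _)) (c • x) s
  simp only [ou, hs']
  rw [show s * (pd i f x * ∫ z, pd i f (c • x + s • z) ∂gauss n) =
    pd i f x * (s * ∫ z, pd i f (c • x + s • z) ∂gauss n) by ring, h3, ← integral_const_mul,
    ← integral_neg]
  refine integral_congr_ae (ae_of_all _ fun z => ?_)
  simp only
  ring

lemma sin_mul_integral_pd_mul_ou_le (hf : ContDiff ℝ 1 f) (hf1 : ∀ x, |f x| ≤ 1) {B : ℝ}
    {i : Fin n} (hB : ∀ x, |pd i f x| ≤ B) {a : ℝ} (ha0 : 0 < a) (ha : gnorm1 (pd i f) ≤ a)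
    {θ : ℝ} (hθ : θ ∈ Set.Ioo 0 (Real.pi / 2)) :
    Real.sin θ * ∫ x, pd i f x * ou (Real.cos θ) (pd i f) x ∂gauss n ≤
      2 * a * Real.exp (-(1 / (8 * Real.pi ^ 2) * max (Real.log (1 / a)) 0 * θ ^ 2)) := by
  obtain ⟨hθ0, hθ1⟩ := hθ
  have hpi := Real.pi_pos
  have hpm : Measurable (pd i f) := measurable_pd hf i
  have hcos0 : 0 < Real.cos θ := Real.cos_pos_of_mem_Ioo ⟨by linarith, hθ1⟩
  have hsin0 : 0 ≤ Real.sin θ := Real.sin_nonneg_of_nonneg_of_le_pi hθ0.le (by linarith)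
  have hq := Real.cos_le_one_sub_mul_cos_sq (x := θ) (by rw [abs_of_pos hθ0]; linarith)
  have hsc := Real.sin_sq_add_cos_sq θ
  have hcos1 : Real.cos θ < 1 := by
    have : 0 < 2 / Real.pi ^ 2 * θ ^ 2 := by positivity
    linarith
  set ρ := Real.cos θ
  obtain ⟨s, hs0, hs⟩ : ∃ s, 0 < s ∧ s ^ 2 = ρ := ⟨√ρ, Real.sqrt_pos.2 hcos0, Real.sq_sqrt hcos0.le⟩
  obtain ⟨r, hr0, hr⟩ : ∃ r, 0 < r ∧ r ^ 2 = s := ⟨√s, Real.sqrt_pos.2 hs0, Real.sq_sqrt hs0.le⟩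
  have hs1 : s < 1 := by nlinarith
  have hr1 : r < 1 := by nlinarith
  have hM := abs_ou_pd_le hf hf1 hB hr0.le hr1
  rw [hr] at hM
  have hsq : 0 < √(1 - s) := Real.sqrt_pos.2 (by linarith)
  have hM1 : 1 ≤ 1 / √(1 - s) := by
    rw [le_div_iff₀ hsq, one_mul]
    exact Real.sqrt_le_one.2 (by linarith)
  have key := integral_mul_ou_le_exp (measurable_ou hpm r) hM ha0
    ((integral_abs_ou_le hpm hB hr0.le hr1.le).trans ha) hM1 hs0.le hs1
  rw [ou_ou hpm hB hs0.le hs1.le hr0.le hr1.le] at key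
  have hcomm := integral_mul_ou_comm (ρ := r) (measurable_ou hpm (s * r)) (abs_ou_le hB (s * r))
    hpm hB hr0.le hr1.le
  rw [ou_ou hpm hB hr0.le hr1.le (by positivity) (by nlinarith),
    show r * (s * r) = ρ by rw [← hs, sq, ← hr]; ring] at hcomm
  simp_rw [mul_comm (ou r (pd i f) _)] at key
  rw [hcomm]
  have hsin : Real.sin θ * (1 / √(1 - s)) ≤ 2 := by
    rw [mul_one_div, div_le_iff₀ hsq]
    refine (le_abs_self _).trans (abs_le_of_sq_le_sq ?_ (by positivity))
    rw [mul_pow, Real.sq_sqrt (by linarith)]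
    have : Real.sin θ ^ 2 = (1 - s) * ((1 + s) * (1 + ρ)) := by
      linear_combination hsc + (1 + ρ) * hs
    rw [this]
    have : (1 + s) * (1 + ρ) ≤ 4 := by nlinarith
    nlinarith
  have hexp : 1 / (8 * Real.pi ^ 2) * max (Real.log (1 / a)) 0 * θ ^ 2 ≤
      (1 - s) / 8 * max (Real.log (1 / a)) 0 := by
    have h1 : 1 - ρ ≤ 2 * (1 - s) := by nlinarith
    have h2 : 1 / (8 * Real.pi ^ 2) * θ ^ 2 ≤ (1 - s) / 8 := by
      have : 1 / (8 * Real.pi ^ 2) * θ ^ 2 = (2 / Real.pi ^ 2 * θ ^ 2) / 16 := by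
        field_simp; norm_num
      rw [this]
      linarith
    calc _ = 1 / (8 * Real.pi ^ 2) * θ ^ 2 * max (Real.log (1 / a)) 0 := by ring
      _ ≤ _ := mul_le_mul_of_nonneg_right h2 (le_max_right _ _)
  calc _ ≤ Real.sin θ * (a * (1 / √(1 - s)) *
        Real.exp (-((1 - s) / 8 * max (Real.log (1 / a)) 0))) :=
        mul_le_mul_of_nonneg_left key hsin0
    _ = (Real.sin θ * (1 / √(1 - s))) * a *
        Real.exp (-((1 - s) / 8 * max (Real.log (1 / a)) 0)) := by ring
    _ ≤ _ := by gcongr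

lemma integral_exp_neg_mul_sq_le {L : ℝ} (hL : 0 ≤ L) :
    ∫ θ in (0 : ℝ)..Real.pi / 2, Real.exp (-(1 / (8 * Real.pi ^ 2) * L * θ ^ 2)) ≤
      2 * √(8 * Real.pi ^ 3) / √(1 + L) := by
  have hpi := Real.pi_pos
  set c := 1 / (8 * Real.pi ^ 2)
  have hc : 0 < c := by positivity
  have hi := integrable_exp_neg_mul_sq (b := c * (1 + L)) (by positivity)
  have hle : ∀ θ ∈ Set.Icc 0 (Real.pi / 2),
      Real.exp (-(c * L * θ ^ 2)) ≤ 2 * Real.exp (-(c * (1 + L)) * θ ^ 2) := fun θ hθ => by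
    have h1 : c * θ ^ 2 ≤ 1 / 2 := by
      have : θ ^ 2 ≤ (Real.pi / 2) ^ 2 := pow_le_pow_left₀ hθ.1 hθ.2 2
      calc c * θ ^ 2 ≤ c * (Real.pi / 2) ^ 2 := by gcongr
        _ ≤ 1 / 2 := by simp only [c]; field_simp; norm_num
    have h2 : Real.exp (c * θ ^ 2) ≤ 2 := by
      refine (Real.exp_le_exp.2 (h1.trans (b := 1 / 2) le_rfl)).trans ?_
      refine (le_abs_self _).trans (abs_le_of_sq_le_sq ?_ (by norm_num))
      rw [← Real.exp_nat_mul]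
      norm_num
      linarith [Real.exp_one_lt_d9]
    calc Real.exp (-(c * L * θ ^ 2))
        = Real.exp (c * θ ^ 2) * Real.exp (-(c * (1 + L)) * θ ^ 2) := by
          rw [← Real.exp_add]; ring_nf
      _ ≤ _ := by gcongr
  calc _ ≤ ∫ θ in (0 : ℝ)..Real.pi / 2, 2 * Real.exp (-(c * (1 + L)) * θ ^ 2) :=
        intervalIntegral.integral_mono_on (by positivity)
          (Continuous.intervalIntegrable (by fun_prop) _ _)
          (Continuous.intervalIntegrable (by fun_prop) _ _) hle
    _ ≤ ∫ θ, 2 * Real.exp (-(c * (1 + L)) * θ ^ 2) := by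
        rw [intervalIntegral.integral_of_le (by positivity)]
        exact setIntegral_le_integral (hi.const_mul 2) (ae_of_all _ fun θ => by positivity)
    _ = _ := by
        rw [integral_const_mul, integral_gaussian, mul_div_assoc, ← Real.sqrt_div (by positivity)]
        congr 2
        simp only [c]
        field_simp

lemma varG_le_of_bounded (hf : ContDiff ℝ 1 f) (hf1 : ∀ x, |f x| ≤ 1) {B : ℝ}
    (hB : ∀ i x, |pd i f x| ≤ B) {a : Fin n → ℝ} (ha0 : ∀ i, 0 < a i)
    (ha : ∀ i, gnorm1 (pd i f) ≤ a i) :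
    varG f ≤ 4 * √(8 * Real.pi ^ 3) *
      ∑ i, a i / √(1 + max (Real.log (1 / a i)) 0) := by
  have hpi := Real.pi_pos
  have hfm : Measurable f := hf.continuous.measurable
  have hd := hasDerivAt_integral_rotation hf hf1 hB
  set φ : ℝ → ℝ := fun θ => ∫ p, f p.1 * f (Real.cos θ • p.1 + Real.sin θ • p.2)
    ∂(gauss n).prod (gauss n) with hφ
  have hφ0 : φ 0 = ∫ x, f x ^ 2 ∂gauss n := by
    simp only [hφ, Real.cos_zero, Real.sin_zero, one_smul, zero_smul, add_zero, ← sq]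
    exact integral_comp_measurePreserving measurePreserving_fst (f := fun x => f x ^ 2)
      (by fun_prop)
  have hφ1 : φ (Real.pi / 2) = (∫ x, f x ∂gauss n) ^ 2 := by
    simp only [hφ, Real.cos_pi_div_two, Real.sin_pi_div_two, one_smul, zero_smul, zero_add]
    rw [integral_prod_mul, sq]
  have hvar : varG f = -φ (Real.pi / 2) - -φ 0 := by rw [varG, hφ0, hφ1]; ring
  rw [hvar]
  refine (intervalIntegral.sub_le_integral_of_hasDeriv_right_of_le (by positivity)
    (continuous_iff_continuousAt.2 fun θ => (hd θ).neg.continuousAt).continuousOn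
    (fun θ _ => (hd θ).neg.hasDerivWithinAt)
    (φ := fun θ => ∑ i, 2 * a i *
      Real.exp (-(1 / (8 * Real.pi ^ 2) * max (Real.log (1 / a i)) 0 * θ ^ 2)))
    (Continuous.integrableOn_Icc (by fun_prop)) fun θ hθ => ?_).trans ?_
  · rw [← Finset.sum_neg_distrib]
    refine Finset.sum_le_sum fun i _ => ?_
    have hsin0 : 0 ≤ Real.sin θ := Real.sin_nonneg_of_nonneg_of_le_pi hθ.1.le (by linarith [hθ.2])
    rw [integral_rotation_mul_pd hf hf1 (hB i) (Real.cos_sq_add_sin_sq θ) hsin0, neg_neg]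
    exact sin_mul_integral_pd_mul_ou_le hf hf1 (hB i) (ha0 i) (ha i) hθ
  · rw [intervalIntegral.integral_finsetSum fun i _ =>
      Continuous.intervalIntegrable (by fun_prop) _ _, Finset.mul_sum]
    refine Finset.sum_le_sum fun i _ => ?_
    rw [intervalIntegral.integral_const_mul]
    have h2a : 0 ≤ 2 * a i := by linarith [ha0 i]
    refine (mul_le_mul_of_nonneg_left (integral_exp_neg_mul_sq_le (le_max_right _ _)) h2a).trans
      (le_of_eq ?_)
    ring

end Interpolation

section Cutoff

variable {n : ℕ} {f χ : (Fin n → ℝ) → ℝ}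

lemma exists_abs_pd_le_of_hasCompactSupport (hf : ContDiff ℝ 1 f) (hc : HasCompactSupport f) :
    ∃ B, ∀ i x, |pd i f x| ≤ B := by
  obtain ⟨B, hB⟩ := (hf.continuous_fderiv one_ne_zero).bounded_above_of_compact_support
    (hc.fderiv (𝕜 := ℝ))
  refine ⟨B, fun i x => ((fderiv ℝ f x).le_opNorm _).trans ?_⟩
  rw [Pi.norm_single, norm_one, mul_one]
  exact hB x

lemma pd_mul (hf : ContDiff ℝ 1 f) (hχ : ContDiff ℝ 1 χ) (i : Fin n) (x : Fin n → ℝ) :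
    pd i (fun x => f x * χ x) x = f x * pd i χ x + χ x * pd i f x := by
  simp only [pd]
  rw [fderiv_fun_mul (hf.differentiable one_ne_zero x) (hχ.differentiable one_ne_zero x)]
  simp

lemma gnorm1_pd_cutoff_le (hf : ContDiff ℝ 1 f) (hf1 : ∀ x, |f x| ≤ 1) (hχ : ContDiff ℝ 1 χ)
    (hχ1 : ∀ x, |χ x| ≤ 1) {i : Fin n} (hi : Integrable (pd i f) (gauss n)) {D : ℝ}
    (hD : ∀ x, |pd i χ x| ≤ D) {ε : ℝ} (hε : 0 ≤ ε) :
    gnorm1 (pd i fun x => f x * χ (ε • x)) ≤ gnorm1 (pd i f) + ε * D := by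
  have hχε : ContDiff ℝ 1 fun x => χ (ε • x) := hχ.comp (by fun_prop)
  have hpt : ∀ x, |pd i (fun x => f x * χ (ε • x)) x| ≤ |pd i f x| + ε * D := fun x => by
    have h := pd_comp_affine hχ i 0 ε x
    simp only [zero_add] at h
    rw [pd_mul hf hχε, h, add_comm]
    refine (abs_add_le _ _).trans (add_le_add ?_ ?_)
    · rw [abs_mul]
      exact mul_le_of_le_one_left (abs_nonneg _) (hχ1 _)
    · rw [abs_mul, abs_mul, abs_of_nonneg hε]
      exact (mul_le_of_le_one_left (by positivity) (hf1 x)).trans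
        (mul_le_mul_of_nonneg_left (hD _) hε)
  have hI : Integrable (fun x => |pd i f x| + ε * D) (gauss n) := hi.abs.add (integrable_const _)
  calc _ ≤ ∫ x, (|pd i f x| + ε * D) ∂gauss n :=
        integral_mono_of_nonneg (ae_of_all _ fun x => abs_nonneg _) hI (ae_of_all _ hpt)
    _ = _ := by
        rw [integral_add hi.abs (integrable_const _)]
        simp [gnorm1]

lemma tendsto_varG_cutoff (hf : Measurable f) (hf1 : ∀ x, |f x| ≤ 1) (hχ : Continuous χ)
    (hχ1 : ∀ x, |χ x| ≤ 1) (hχ0 : χ 0 = 1) {ε : ℕ → ℝ}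
    (hε : Filter.Tendsto ε Filter.atTop (nhds 0)) :
    Filter.Tendsto (fun k => varG fun x => f x * χ (ε k • x)) Filter.atTop (nhds (varG f)) := by
  have hχm := hχ.measurable
  have hb : ∀ k x, |f x * χ (ε k • x)| ≤ 1 := fun k x => by
    simpa using abs_mul_le_mul (hf1 x) (hχ1 (ε k • x))
  have hlim : ∀ x, Filter.Tendsto (fun k => f x * χ (ε k • x)) Filter.atTop (nhds (f x)) :=
    fun x => by
      have : Filter.Tendsto (fun k => χ (ε k • x)) Filter.atTop (nhds (χ ((0 : ℝ) • x))) :=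
        (hχ.tendsto _).comp (hε.smul_const x)
      rw [zero_smul, hχ0] at this
      simpa using this.const_mul (f x)
  refine Filter.Tendsto.sub ?_ (Filter.Tendsto.pow ?_ 2)
  · refine tendsto_integral_of_dominated_convergence (fun _ => 1)
      (fun k => Measurable.aestronglyMeasurable (by fun_prop)) (integrable_const _)
      (fun k => ae_of_all _ fun x => ?_) (ae_of_all _ fun x => (hlim x).pow 2)
    rw [norm_pow]
    exact pow_le_one₀ (norm_nonneg _) (hb k x)
  · exact tendsto_integral_of_dominated_convergence (fun _ => 1)
      (fun k => Measurable.aestronglyMeasurable (by fun_prop)) (integrable_const _)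
      (fun k => ae_of_all _ fun x => hb k x) (ae_of_all _ hlim)

lemma tendsto_div_sqrt_one_add_log {a : ℝ} (ha : 0 ≤ a) {u : ℕ → ℝ} (hu0 : ∀ k, 0 < u k)
    (hu : Filter.Tendsto u Filter.atTop (nhds a)) :
    Filter.Tendsto (fun k => u k / √(1 + max (Real.log (1 / u k)) 0)) Filter.atTop
      (nhds (a / √(1 + max (Real.log (1 / a)) 0))) := by
  have hpos : ∀ t : ℝ, 1 ≤ √(1 + max t 0) := fun t =>
    Real.one_le_sqrt.2 (by linarith [le_max_right t 0])
  rcases ha.eq_or_lt with rfl | ha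
  · rw [zero_div]
    refine squeeze_zero (fun k => div_nonneg (hu0 k).le (Real.sqrt_nonneg _)) (fun k => ?_) hu
    exact div_le_self (hu0 k).le (hpos _)
  · refine hu.div (Filter.Tendsto.sqrt (Filter.Tendsto.const_add 1 (Filter.Tendsto.max ?_
      tendsto_const_nhds))) (by linarith [hpos (Real.log (1 / a))])
    exact (tendsto_const_nhds.div hu ha.ne').log (by positivity)

lemma varG_le_sum (hf : ContDiff ℝ 1 f) (hf1 : ∀ x, |f x| ≤ 1)
    (hi : ∀ i, Integrable (pd i f) (gauss n)) :
    varG f ≤ 4 * √(8 * Real.pi ^ 3) *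
      ∑ i, gnorm1 (pd i f) / √(1 + max (Real.log (1 / gnorm1 (pd i f))) 0) := by
  have χ : ContDiffBump (0 : Fin n → ℝ) := ⟨1, 2, zero_lt_one, one_lt_two⟩
  have hχ : ContDiff ℝ 1 χ := χ.contDiff
  have hχ1 : ∀ x, |χ x| ≤ 1 := fun x => by rw [abs_of_nonneg χ.nonneg]; exact χ.le_one
  have hχ0 : χ 0 = 1 := χ.one_of_mem_closedBall (Metric.mem_closedBall_self χ.rIn_pos.le)
  obtain ⟨D, hD⟩ := exists_abs_pd_le_of_hasCompactSupport hχ χ.hasCompactSupport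
  set ε : ℕ → ℝ := fun k => 1 / ((k : ℝ) + 1)
  have hε0 : ∀ k, 0 < ε k := fun k => Nat.one_div_pos_of_nat
  have hε : Filter.Tendsto ε Filter.atTop (nhds 0) := tendsto_one_div_add_atTop_nhds_zero_nat
  have hg : ∀ i, 0 ≤ gnorm1 (pd i f) := fun i => integral_nonneg fun x => abs_nonneg _
  have ha0 : ∀ i k, 0 < gnorm1 (pd i f) + ε k * (|D| + 1) := fun i k =>
    add_pos_of_nonneg_of_pos (hg i) (mul_pos (hε0 k) (by positivity))
  have ha : ∀ i, Filter.Tendsto (fun k => gnorm1 (pd i f) + ε k * (|D| + 1)) Filter.atTop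
      (nhds (gnorm1 (pd i f))) := fun i => by
    simpa using (hε.mul_const (|D| + 1)).const_add (gnorm1 (pd i f))
  refine le_of_tendsto_of_tendsto' (tendsto_varG_cutoff hf.continuous.measurable hf1
    hχ.continuous hχ1 hχ0 hε) ((tendsto_finsetSum Finset.univ fun i _ =>
      tendsto_div_sqrt_one_add_log (hg i) (ha0 i) (ha i)).const_mul _) fun k => ?_
  have hfk : ContDiff ℝ 1 fun x => f x * χ (ε k • x) := hf.mul (hχ.comp (by fun_prop))
  have hck : HasCompactSupport fun x => f x * χ (ε k • x) :=
    (χ.hasCompactSupport.comp_smul (hε0 k).ne').mul_left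
  obtain ⟨B, hB⟩ := exists_abs_pd_le_of_hasCompactSupport hfk hck
  refine varG_le_of_bounded hfk (fun x => ?_) hB (fun i => ha0 i k) fun i => ?_
  · simpa using abs_mul_le_mul (hf1 x) (hχ1 (ε k • x))
  · refine gnorm1_pd_cutoff_le hf hf1 hχ hχ1 (hi i) (fun x => ?_) (hε0 k).le
    linarith [hD i x, le_abs_self D]

end Cutoff

end Gaussian

/-- Cordero-Erausquin–Ledoux: for smooth `f : ℝⁿ → ℝ` with `|f| ≤ 1`,
`Var(f) ≤ C Σᵢ ‖∂ᵢ f‖₁ (1 + ‖∂ᵢ f‖₁) / [1 + log⁺(1/‖∂ᵢ f‖₁)]^{1/2}`. -/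
theorem cordero_erausquin_ledoux :
    ∃ C : ℝ, 0 < C ∧ ∀ n : ℕ, 1 ≤ n → ∀ f : (Fin n → ℝ) → ℝ,
      ContDiff ℝ 1 f → (∀ i : Fin n, Integrable (pd i f) (gauss n)) →
      (∀ x, |f x| ≤ 1) →
      varG f ≤ C * ∑ i : Fin n,
        if (pd i f) =ᵐ[gauss n] 0 then 0 else
          gnorm1 (pd i f) * (1 + gnorm1 (pd i f)) /
            Real.sqrt (1 + max (Real.log (1 / gnorm1 (pd i f))) 0) := by
  have hpi := Real.pi_pos
  refine ⟨4 * √(8 * Real.pi ^ 3), by positivity, fun n _ f hf hi hf1 =>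
    (varG_le_sum hf hf1 hi).trans ?_⟩
  gcongr with i
  split_ifs with h
  · have h0 : gnorm1 (pd i f) = 0 := by
      rw [gnorm1, integral_congr_ae (g := fun _ => 0) (h.mono fun x hx => by simp [hx])]
      simp
    simp [h0]
  · have h0 : 0 ≤ gnorm1 (pd i f) := integral_nonneg fun x => abs_nonneg _
    gcongr
    nlinarith
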